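/- Let s ∈ ℂ with Re(s) > −1. Then for every real t > 0, one has ∑_{p ≤ x} p^s = Ei((s+1)·log x) + O(x^{Re(s)+1}·(log x)^{−t}) as x → ∞ (x real), where the sum is over primes p ≤ x. -/

import Mathlib

open Filter

/-- The exponential integral `Ei(z) = γ + Log z + ∑_{k=1}^∞ z^k/(k·k!)`
(for `z ∉ (−∞,0]`, with `Log` the principal branch of the logarithm). -/
noncomputable def complexEi (z : ℂ) : ℂ :=
  (Real.eulerMascheroniConstant : ℂ) + Complex.log z +
    ∑' k : ℕ, z ^ (k + 1) / (((k : ℂ) + 1) * (Nat.factorial (k + 1) : ℂ))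

/-- `π_s(x) = ∑_{p ≤ x} p^s`, the sum over primes `p ≤ x`. -/
noncomputable def piPow (s : ℂ) (x : ℝ) : ℂ :=
  ∑ p ∈ (⌊x⌋₊ + 1).primesBelow, (p : ℂ) ^ s

section

open Complex Topology Set MeasureTheory

/-- The `m`-th term of the expansion of `(s - 1) ζ(s) - 1` over the intervals `[m + 1, m + 2]`. -/
noncomputable def zetaTerm (m : ℕ) (s : ℂ) : ℂ :=
  (s - 1) * ((m + 1 : ℝ) : ℂ) ^ (-s) +
    (((m + 2 : ℝ) : ℂ) ^ (1 - s) - ((m + 1 : ℝ) : ℂ) ^ (1 - s))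

lemma norm_cpow_neg_sub_le {s : ℂ} (hs : 0 ≤ s.re) {a : ℝ} (ha : 0 < a) {u : ℝ}
    (hu : u ∈ Icc a (a + 1)) :
    ‖(u : ℂ) ^ (-s) - (a : ℂ) ^ (-s)‖ ≤ ‖s‖ * a ^ (-s.re - 1) := by
  rcases eq_or_ne s 0 with rfl | h0
  · simp
  have := norm_image_sub_le_of_norm_deriv_le_segment' (f := fun u : ℝ => (u : ℂ) ^ (-s))
    (f' := fun u : ℝ => -s * (u : ℂ) ^ (-s - 1)) (C := ‖s‖ * a ^ (-s.re - 1))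
    (a := a) (b := a + 1) (fun x hx => ?_) (fun x hx => ?_) u hu
  · refine this.trans (mul_le_of_le_one_right (by positivity) (by linarith [hu.2]))
  · exact (hasDerivAt_ofReal_cpow_const (by linarith [hx.1] : x ≠ 0)
      (neg_ne_zero.2 h0)).hasDerivWithinAt
  · have hx0 : 0 < x := ha.trans_le hx.1
    rw [norm_mul, norm_neg, norm_cpow_eq_rpow_re_of_pos hx0]
    simp only [sub_re, neg_re, one_re]
    exact mul_le_mul_of_nonneg_left (Real.rpow_le_rpow_of_nonpos ha hx.1 (by linarith))
      (norm_nonneg _)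

lemma norm_zetaTerm_le_of_forall {s : ℂ} (hs1 : s ≠ 1) (m : ℕ) {C : ℝ}
    (hC : ∀ u ∈ Icc (m + 1 : ℝ) (m + 2), ‖(u : ℂ) ^ (-s) - ((m + 1 : ℝ) : ℂ) ^ (-s)‖ ≤ C) :
    ‖zetaTerm m s‖ ≤ ‖s - 1‖ * C := by
  have hm : (0 : ℝ) < m + 1 := by positivity
  have key := norm_image_sub_le_of_norm_deriv_le_segment'
    (f := fun u : ℝ => (s - 1) * ((m + 1 : ℝ) : ℂ) ^ (-s) * u + (u : ℂ) ^ (1 - s))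
    (f' := fun u : ℝ => (s - 1) * ((m + 1 : ℝ) : ℂ) ^ (-s) * 1 + (1 - s) * (u : ℂ) ^ (1 - s - 1))
    (C := ‖s - 1‖ * C)
    (a := (m + 1 : ℝ)) (b := m + 2) (fun x hx => ?_) (fun x hx => ?_) (m + 2)
    ⟨by linarith, le_rfl⟩
  · convert key using 1
    · congr 1
      rw [zetaTerm]; push_cast; ring
    · ring
  · have h1 : HasDerivAt (fun u : ℝ => (u : ℂ)) 1 x := Complex.ofRealCLM.hasDerivAt
    exact ((h1.const_mul _).add (hasDerivAt_ofReal_cpow_const (by linarith [hx.1] : x ≠ 0)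
      (sub_ne_zero.2 hs1.symm))).hasDerivWithinAt
  · rw [show (s - 1) * ((m + 1 : ℝ) : ℂ) ^ (-s) * 1 + (1 - s) * (x : ℂ) ^ (1 - s - 1)
      = -((s - 1) * ((x : ℂ) ^ (-s) - ((m + 1 : ℝ) : ℂ) ^ (-s))) by
      rw [show 1 - s - 1 = -s by ring]; ring, norm_neg, norm_mul]
    gcongr
    exact hC x ⟨hx.1, hx.2.le⟩

lemma norm_zetaTerm_le {s : ℂ} (hs : 0 ≤ s.re) {θ : ℝ} (hθ : 0 ≤ θ) (hθ1 : θ ≤ 1) (m : ℕ) :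
    ‖zetaTerm m s‖ ≤ 2 * ‖s - 1‖ * ‖s‖ ^ θ * (m + 1 : ℝ) ^ (-(s.re + θ)) := by
  rcases eq_or_ne s 1 with rfl | hs1
  · simp [zetaTerm]
  have hm : (0 : ℝ) < m + 1 := by positivity
  rw [show 2 * ‖s - 1‖ * ‖s‖ ^ θ * (m + 1 : ℝ) ^ (-(s.re + θ)) =
    ‖s - 1‖ * (2 * ‖s‖ ^ θ * (m + 1 : ℝ) ^ (-(s.re + θ))) by ring]
  refine norm_zetaTerm_le_of_forall hs1 m fun u hu => ?_
  have hu0 : 0 < u := hm.trans_le hu.1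
  set D := ‖(u : ℂ) ^ (-s) - ((m + 1 : ℝ) : ℂ) ^ (-s)‖
  have h1 : D ≤ ‖s‖ * (m + 1 : ℝ) ^ (-s.re - 1) :=
    norm_cpow_neg_sub_le hs hm ⟨hu.1, by linarith [hu.2]⟩
  have h2 : D ≤ 2 * (m + 1 : ℝ) ^ (-s.re) := by
    refine (norm_sub_le _ _).trans ?_
    rw [norm_cpow_eq_rpow_re_of_pos hu0, norm_cpow_eq_rpow_re_of_pos hm, neg_re]
    have := Real.rpow_le_rpow_of_nonpos hm hu.1 (by linarith : -s.re ≤ 0)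
    linarith
  have hD : 0 ≤ D := norm_nonneg _
  calc D = D ^ θ * D ^ (1 - θ) := by
        rw [← Real.rpow_add_of_nonneg hD hθ (by linarith)]; simp
    _ ≤ (‖s‖ * (m + 1 : ℝ) ^ (-s.re - 1)) ^ θ * (2 * (m + 1 : ℝ) ^ (-s.re)) ^ (1 - θ) := by
        gcongr
    _ = 2 ^ (1 - θ) * (‖s‖ ^ θ * (m + 1 : ℝ) ^ (-(s.re + θ))) := by
        rw [Real.mul_rpow (by positivity) (by positivity),
          Real.mul_rpow (by positivity) (by positivity), ← Real.rpow_mul hm.le,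
          ← Real.rpow_mul hm.le, show -(s.re + θ) = (-s.re - 1) * θ + -s.re * (1 - θ) by ring,
          Real.rpow_add hm]
        ring
    _ ≤ 2 ^ (1 : ℝ) * (‖s‖ ^ θ * (m + 1 : ℝ) ^ (-(s.re + θ))) := by
        gcongr <;> linarith
    _ = _ := by rw [Real.rpow_one]; ring

lemma summable_natCast_add_one_rpow {r : ℝ} (hr : 1 < r) :
    Summable fun m : ℕ => (m + 1 : ℝ) ^ (-r) := by
  have := (summable_nat_add_iff 1).2 (Real.summable_nat_rpow.2 (by linarith : -r < -1))
  simpa using this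

lemma summable_zetaTerm {s : ℂ} (hs : 0 < s.re) : Summable fun m => zetaTerm m s :=
  Summable.of_norm_bounded
    ((summable_natCast_add_one_rpow (by linarith : 1 < s.re + 1)).mul_left _)
    fun m => norm_zetaTerm_le hs.le zero_le_one le_rfl m

lemma differentiable_zetaTerm (m : ℕ) : Differentiable ℂ (zetaTerm m) := by
  have h1 : ((m + 1 : ℝ) : ℂ) ≠ 0 := by exact_mod_cast Nat.succ_ne_zero m
  have h2 : ((m + 2 : ℝ) : ℂ) ≠ 0 := by exact_mod_cast Nat.succ_ne_zero (m + 1)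
  unfold zetaTerm
  intro s
  refine DifferentiableAt.add (.mul (by fun_prop) (.const_cpow (by fun_prop) (.inl h1)))
    (.sub (.const_cpow (by fun_prop) (.inl h2)) (.const_cpow (by fun_prop) (.inl h1)))

lemma differentiableOn_tsum_zetaTerm :
    DifferentiableOn ℂ (fun s => ∑' m, zetaTerm m s) {s | 0 < s.re} := by
  intro s hs
  have hs : 0 < s.re := hs
  set U : Set ℂ := {z | s.re / 2 < z.re} ∩ Metric.ball 0 (‖s‖ + 1)
  have hU : IsOpen U := (isOpen_lt continuous_const continuous_re).inter Metric.isOpen_ball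
  have hsU : s ∈ U := ⟨by simp; linarith, by simp⟩
  refine DifferentiableAt.differentiableWithinAt ?_
  refine DifferentiableOn.differentiableAt (s := U) ?_ (hU.mem_nhds hsU)
  refine Complex.differentiableOn_tsum_of_summable_norm
    (u := fun m : ℕ => 2 * (‖s‖ + 2) * (‖s‖ + 1) * (m + 1 : ℝ) ^ (-(s.re / 2 + 1)))
    ((summable_natCast_add_one_rpow (by linarith)).mul_left _)
    (fun m => (differentiable_zetaTerm m).differentiableOn) hU ?_
  rintro m w ⟨hw1, hw2⟩
  have hw1 : s.re / 2 < w.re := hw1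
  have hw2 : ‖w‖ < ‖s‖ + 1 := by simpa using hw2
  refine (norm_zetaTerm_le (by linarith) zero_le_one le_rfl m).trans ?_
  rw [Real.rpow_one]
  have : ‖w - 1‖ ≤ ‖s‖ + 2 := (norm_sub_le _ _).trans (by rw [norm_one]; linarith)
  gcongr
  linarith

lemma tsum_zetaTerm_of_one_lt_re {s : ℂ} (hs : 1 < s.re) :
    ∑' m, zetaTerm m s = (s - 1) * riemannZeta s - 1 := by
  have h1 : HasSum (fun m : ℕ => (s - 1) * ((m + 1 : ℝ) : ℂ) ^ (-s))
      ((s - 1) * riemannZeta s) := by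
    rw [zeta_eq_tsum_one_div_nat_add_one_cpow hs]
    refine HasSum.mul_left _ ?_
    have : Summable fun m : ℕ => ((m + 1 : ℝ) : ℂ) ^ (-s) := by
      refine Summable.of_norm_bounded (summable_natCast_add_one_rpow hs) fun m => ?_
      rw [norm_cpow_eq_rpow_re_of_pos (by positivity), neg_re]
    have e : ∑' n : ℕ, 1 / (n + 1 : ℂ) ^ s = ∑' n : ℕ, ((n + 1 : ℝ) : ℂ) ^ (-s) :=
      tsum_congr fun m => by rw [cpow_neg, one_div]; push_cast; rfl
    exact e ▸ this.hasSum
  have h2 := (summable_zetaTerm (by linarith : 0 < s.re)).hasSum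
  have h3 := h2.sub h1
  simp only [zetaTerm, add_sub_cancel_left] at h3
  have h4 := h3.tendsto_sum_nat
  have h5 : Tendsto (fun n : ℕ => ∑ m ∈ Finset.range n,
      (((m + 2 : ℝ) : ℂ) ^ (1 - s) - ((m + 1 : ℝ) : ℂ) ^ (1 - s))) atTop (𝓝 (-1)) := by
    have e : ∀ n : ℕ, ∑ m ∈ Finset.range n,
      (((m + 2 : ℝ) : ℂ) ^ (1 - s) - ((m + 1 : ℝ) : ℂ) ^ (1 - s)) =
        ((n + 1 : ℝ) : ℂ) ^ (1 - s) - 1 := by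
      intro n
      have := Finset.sum_range_sub (fun m : ℕ => ((m + 1 : ℝ) : ℂ) ^ (1 - s)) n
      simp only [Nat.cast_add, Nat.cast_one, CharP.cast_eq_zero, zero_add, ofReal_one,
        one_cpow] at this
      rw [← this]
      refine Finset.sum_congr rfl fun m _ => ?_
      rw [add_assoc, one_add_one_eq_two]
    simp only [e]
    rw [show (-1 : ℂ) = 0 - 1 by ring]
    refine Tendsto.sub_const ?_ _
    rw [tendsto_zero_iff_norm_tendsto_zero]
    have e2 : ∀ n : ℕ, ‖((n + 1 : ℝ) : ℂ) ^ (1 - s)‖ = (n + 1 : ℝ) ^ (-(s.re - 1)) := by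
      intro n
      rw [norm_cpow_eq_rpow_re_of_pos (by positivity)]; simp
    simp only [e2]
    exact (tendsto_rpow_neg_atTop (by linarith)).comp
      (tendsto_atTop_add_const_right _ _ tendsto_natCast_atTop_atTop)
  have := tendsto_nhds_unique h4 h5
  change ∑' m, zetaTerm m s - _ = _ at this
  linear_combination this

lemma sub_one_mul_riemannZeta_eq {s : ℂ} (hs : 0 < s.re) (hs1 : s ≠ 1) :
    (s - 1) * riemannZeta s = 1 + ∑' m, zetaTerm m s := by
  have hd := DirichletCharacter.differentiable_LFunctionTrivChar₁ 1
  have hZ : ∀ z ≠ 1, DirichletCharacter.LFunctionTrivChar₁ 1 z = (z - 1) * riemannZeta z := by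
    intro z hz
    rw [DirichletCharacter.LFunctionTrivChar₁, Function.update_of_ne hz]
    simp [DirichletCharacter.LFunctionTrivChar, DirichletCharacter.LFunction_modOne_eq]
  have hopen : IsOpen {s : ℂ | 0 < s.re} := isOpen_lt continuous_const continuous_re
  have hW : AnalyticOnNhd ℂ (fun s => 1 + ∑' m, zetaTerm m s) {s | 0 < s.re} :=
    (differentiableOn_tsum_zetaTerm.const_add 1).analyticOnNhd hopen
  have hZa : AnalyticOnNhd ℂ (DirichletCharacter.LFunctionTrivChar₁ 1) {s | 0 < s.re} :=
    hd.differentiableOn.analyticOnNhd hopen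
  rw [← hZ s hs1]
  refine hZa.eqOn_of_preconnected_of_eventuallyEq hW
    (convex_halfSpace_re_gt 0).isPreconnected (z₀ := 2) (by simp) ?_ hs
  have : {z : ℂ | 1 < z.re} ∈ 𝓝 (2 : ℂ) :=
    (isOpen_lt continuous_const continuous_re).mem_nhds (by simp)
  filter_upwards [this] with z hz
  have hz : 1 < z.re := hz
  rw [hZ z (by rintro rfl; simp at hz), tsum_zetaTerm_of_one_lt_re hz]
  ring

/-- `|ζ(s)| ≤ 1 / |s - 1| + C |s|^θ` slightly to the left of the line `Re s = 1`. -/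
lemma exists_norm_riemannZeta_le {θ : ℝ} (hθ : 0 < θ) (hθ1 : θ ≤ 1) :
    ∃ C > 0, ∀ s : ℂ, 1 - θ / 2 ≤ s.re → s ≠ 1 →
      ‖riemannZeta s‖ ≤ 1 / ‖s - 1‖ + C * ‖s‖ ^ θ := by
  have hsum := summable_natCast_add_one_rpow (by linarith : 1 < 1 + θ / 2)
  refine ⟨2 * ∑' m : ℕ, (m + 1 : ℝ) ^ (-(1 + θ / 2)), ?_, fun s hs hs1 => ?_⟩
  · refine mul_pos two_pos (hsum.tsum_pos (fun m => by positivity) 0 (by simp))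
  have hpos : 0 < ‖s - 1‖ := norm_pos_iff.2 (sub_ne_zero.2 hs1)
  have key := sub_one_mul_riemannZeta_eq (by linarith : 0 < s.re) hs1
  have hb : ‖∑' m, zetaTerm m s‖ ≤
      2 * ‖s - 1‖ * ‖s‖ ^ θ * ∑' m : ℕ, (m + 1 : ℝ) ^ (-(1 + θ / 2)) := by
    refine tsum_of_norm_bounded (hsum.hasSum.mul_left _) fun m => ?_
    refine (norm_zetaTerm_le (by linarith) hθ.le hθ1 m).trans ?_
    exact mul_le_mul_of_nonneg_left (Real.rpow_le_rpow_of_exponent_le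
      (by linarith [m.cast_nonneg (α := ℝ)]) (by linarith)) (by positivity)
  have : ‖s - 1‖ * ‖riemannZeta s‖ ≤
      1 + 2 * ‖s - 1‖ * ‖s‖ ^ θ * ∑' m : ℕ, (m + 1 : ℝ) ^ (-(1 + θ / 2)) := by
    rw [← norm_mul, key]
    exact (norm_add_le _ _).trans (by rw [norm_one]; gcongr)
  rw [← mul_le_mul_iff_right₀ hpos]
  refine this.trans (le_of_eq ?_)
  field_simp

lemma exists_norm_riemannZeta_le_rpow {θ : ℝ} (hθ : 0 < θ) (hθ1 : θ ≤ 1) :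
    ∃ C > 0, ∀ T : ℝ, 1 ≤ T → ∀ s : ℂ, 1 - θ / 2 ≤ s.re → s.re ≤ 4 → 1 / 4 ≤ |s.im| →
      |s.im| ≤ 4 * T → ‖riemannZeta s‖ ≤ C * T ^ θ := by
  obtain ⟨C, hC, h⟩ := exists_norm_riemannZeta_le hθ hθ1
  refine ⟨4 + C * 8, by positivity, fun T hT s h1 h2 h3 h4 => ?_⟩
  have him : 1 / 4 ≤ ‖s - 1‖ := h3.trans (by simpa using abs_im_le_norm (s - 1))
  have hs1 : s ≠ 1 := by rintro rfl; norm_num at h3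
  have hn : ‖s‖ ≤ 8 * T := by
    refine (norm_le_abs_re_add_abs_im s).trans ?_
    rw [abs_of_nonneg (by linarith : 0 ≤ s.re)]
    linarith
  have hT1 : 1 ≤ T ^ θ := Real.one_le_rpow hT hθ.le
  calc ‖riemannZeta s‖ ≤ 1 / ‖s - 1‖ + C * ‖s‖ ^ θ := h s h1 hs1
    _ ≤ 1 / (1 / 4) + C * (8 * T) ^ θ := by gcongr
    _ ≤ 4 * T ^ θ + C * (8 * T ^ θ) := by
        have h8 : (8 : ℝ) ^ θ ≤ 8 := by
          simpa using Real.rpow_le_rpow_of_exponent_le (by norm_num : (1 : ℝ) ≤ 8) hθ1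
        rw [Real.mul_rpow (by norm_num) (by linarith)]
        gcongr
        linarith
    _ = _ := by ring

lemma abs_im_mem_of_norm_sub_le {s z : ℂ} {r : ℝ} (hz : ‖z - s‖ ≤ r) :
    |s.im| - r ≤ |z.im| ∧ |z.im| ≤ |s.im| + r := by
  have h : |z.im - s.im| ≤ r := (by simpa using abs_im_le_norm (z - s) : _ ≤ ‖z - s‖).trans hz
  exact ⟨by linarith [abs_sub_abs_le_abs_sub s.im z.im, abs_sub_comm z.im s.im],
    by linarith [abs_sub_abs_le_abs_sub z.im s.im]⟩

lemma re_mem_of_norm_sub_le {s z : ℂ} {r : ℝ} (hz : ‖z - s‖ ≤ r) :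
    s.re - r ≤ z.re ∧ z.re ≤ s.re + r := by
  have h : |z.re - s.re| ≤ r := (by simpa using abs_re_le_norm (z - s) : _ ≤ ‖z - s‖).trans hz
  exact ⟨by linarith [neg_le_of_abs_le h], by linarith [le_of_abs_le h]⟩

lemma exists_norm_deriv_riemannZeta_le_rpow {θ : ℝ} (hθ : 0 < θ) (hθ1 : θ ≤ 1) :
    ∃ C > 0, ∀ T : ℝ, 1 ≤ T → ∀ s : ℂ, 1 - θ / 4 ≤ s.re → s.re ≤ 3 → 1 / 2 ≤ |s.im| →
      |s.im| ≤ 2 * T → ‖deriv riemannZeta s‖ ≤ C * T ^ θ := by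
  obtain ⟨C, hC, h⟩ := exists_norm_riemannZeta_le_rpow hθ hθ1
  refine ⟨C / (θ / 4), by positivity, fun T hT s h1 h2 h3 h4 => ?_⟩
  have := norm_deriv_le_of_forall_mem_sphere_norm_le (f := riemannZeta) (c := s) (R := θ / 4)
    (C := C * T ^ θ) (by positivity) ?_ fun z hz => ?_
  · convert this using 1; ring
  · refine DifferentiableOn.diffContOnCl fun z hz => ?_
    rw [closure_ball _ (by positivity), Metric.mem_closedBall, dist_eq_norm] at hz
    have := abs_im_mem_of_norm_sub_le hz
    refine (differentiableAt_riemannZeta ?_).differentiableWithinAt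
    rintro rfl
    simp at this
    linarith
  · rw [mem_sphere_iff_norm] at hz
    have a := abs_im_mem_of_norm_sub_le hz.le
    have b := re_mem_of_norm_sub_le hz.le
    exact h T hT z (by linarith) (by linarith) (by linarith) (by linarith)

lemma exists_le_norm_riemannZeta_pow_four {θ : ℝ} (hθ : 0 < θ) (hθ1 : θ ≤ 1) :
    ∃ c > 0, ∀ T : ℝ, 1 ≤ T → ∀ s : ℂ, 1 < s.re → s.re ≤ 3 → 1 / 2 ≤ |s.im| →
      |s.im| ≤ 2 * T → c * (s.re - 1) ^ 3 * T ^ (-θ) ≤ ‖riemannZeta s‖ ^ 4 := by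
  obtain ⟨A, hA, hA'⟩ := exists_norm_riemannZeta_le hθ hθ1
  obtain ⟨B, hB, hB'⟩ := exists_norm_riemannZeta_le_rpow hθ hθ1
  refine ⟨((1 + A * 6) ^ 3 * B)⁻¹, by positivity, fun T hT s h1 h2 h3 h4 => ?_⟩
  set x := s.re - 1
  have hx : 0 < x := by simp only [x]; linarith
  have hx2 : x ≤ 2 := by simp only [x]; linarith
  have hT0 : 0 < T := by linarith
  have key := DirichletCharacter.norm_LFunction_product_ge_one (N := 1) 1 hx s.im
  simp only [DirichletCharacter.LFunctionTrivChar, DirichletCharacter.LFunction_modOne_eq,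
    norm_mul, norm_pow] at key
  have e : 1 + (x : ℂ) + I * s.im = s := by
    apply Complex.ext <;> simp [x]
  rw [e] at key
  have hζ1 : ‖riemannZeta (1 + x)‖ ≤ (1 + A * 6) / x := by
    have hne : (1 + x : ℂ) ≠ 1 := by
      rw [Ne, add_eq_left]; exact_mod_cast hx.ne'
    refine (hA' (1 + x) (by simp; linarith) hne).trans ?_
    have n1 : ‖(1 + x : ℂ) - 1‖ = x := by
      rw [add_sub_cancel_left, norm_real, Real.norm_of_nonneg hx.le]
    have n2 : ‖(1 + x : ℂ)‖ = 1 + x := by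
      rw [← ofReal_one, ← ofReal_add, norm_real, Real.norm_of_nonneg (by linarith)]
    have n3 : (1 + x) ^ θ ≤ 3 := by
      calc (1 + x) ^ θ ≤ (1 + x) ^ (1 : ℝ) :=
            Real.rpow_le_rpow_of_exponent_le (by linarith) hθ1
        _ ≤ 3 := by rw [Real.rpow_one]; linarith
    rw [n1, n2, add_div]
    gcongr
    rw [le_div_iff₀ hx]
    nlinarith [mul_le_mul n3 hx2 hx.le (by norm_num)]
  have hζ2 : ‖riemannZeta (1 + x + 2 * I * s.im)‖ ≤ B * T ^ θ := by
    apply hB' T hT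
    · simp; linarith
    · simp; linarith
    · simp [abs_mul]; linarith
    · simp [abs_mul]; linarith
  have key2 : 1 ≤ ((1 + A * 6) / x) ^ 3 * ‖riemannZeta s‖ ^ 4 * (B * T ^ θ) :=
    key.le.trans (by gcongr)
  rw [Real.rpow_neg hT0.le]
  have hTθ : 0 < T ^ θ := by positivity
  have e3 : ((1 + A * 6) / x) ^ 3 * ‖riemannZeta s‖ ^ 4 * (B * T ^ θ) =
      ‖riemannZeta s‖ ^ 4 * (((1 + A * 6) ^ 3 * B) * T ^ θ / x ^ 3) := by
    field_simp
  rw [e3, ← div_le_iff₀ (by positivity)] at key2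
  refine le_trans (le_of_eq ?_) key2
  field_simp

lemma exists_le_norm_riemannZeta {θ : ℝ} (hθ : 0 < θ) (hθ1 : θ ≤ 1) :
    ∃ c > 0, ∃ κ > 0, κ ≤ θ / 4 ∧ ∀ T : ℝ, 1 ≤ T → ∀ s : ℂ,
      1 - κ * T ^ (-(8 * θ)) ≤ s.re → s.re ≤ 3 → 1 / 2 ≤ |s.im| → |s.im| ≤ 2 * T →
        c * T ^ (-(7 * θ)) ≤ ‖riemannZeta s‖ := by
  obtain ⟨b, hb, hb'⟩ := exists_le_norm_riemannZeta_pow_four hθ hθ1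
  obtain ⟨D, hD, hD'⟩ := exists_norm_deriv_riemannZeta_le_rpow hθ hθ1
  set κ := min (θ / 4) (b / (256 * D ^ 4))
  have hκ : 0 < κ := lt_min (by positivity) (by positivity)
  have hκ1 : κ ≤ θ / 4 := min_le_left _ _
  have hκ2 : 256 * D ^ 4 * κ ≤ b := by
    have : κ ≤ b / (256 * D ^ 4) := min_le_right _ _
    rwa [le_div_iff₀ (by positivity), mul_comm] at this
  refine ⟨2 * D * κ, by positivity, κ, hκ, hκ1, fun T hT s h1 h2 h3 h4 => ?_⟩
  have hT0 : 0 < T := by linarith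
  set δ := κ * T ^ (-(8 * θ)) with hδ
  have hδ0 : 0 < δ := by positivity
  have hδκ : δ ≤ κ :=
    mul_le_of_le_one_right hκ.le (Real.rpow_le_one_of_one_le_of_nonpos hT (by linarith))
  have far : ∀ z : ℂ, 1 + δ ≤ z.re → z.re ≤ 3 → 1 / 2 ≤ |z.im| → |z.im| ≤ 2 * T →
      4 * D * κ * T ^ (-(7 * θ)) ≤ ‖riemannZeta z‖ := by
    intro z z1 z2 z3 z4
    have := hb' T hT z (by linarith) z2 z3 z4
    refine le_of_pow_le_pow_left₀ (n := 4) (by norm_num) (norm_nonneg _) (le_trans ?_ this)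
    calc (4 * D * κ * T ^ (-(7 * θ))) ^ 4
        = (256 * D ^ 4 * κ) * κ ^ 3 * T ^ (-(28 * θ)) := by
          rw [mul_pow _ (T ^ _) 4, ← Real.rpow_natCast (T ^ _) 4, ← Real.rpow_mul hT0.le]
          norm_num
          ring_nf
      _ ≤ b * κ ^ 3 * T ^ (-(25 * θ)) := by
          have := Real.rpow_le_rpow_of_exponent_le hT (by linarith : -(28 * θ) ≤ -(25 * θ))
          gcongr
      _ = b * δ ^ 3 * T ^ (-θ) := by
          rw [hδ, mul_pow κ, ← Real.rpow_natCast (T ^ _) 3, ← Real.rpow_mul hT0.le,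
            mul_assoc, mul_assoc, mul_assoc, ← Real.rpow_add hT0]
          congr 3
          norm_num
          ring
      _ ≤ b * (z.re - 1) ^ 3 * T ^ (-θ) := by gcongr; linarith
  rcases le_or_gt (1 + δ) s.re with hs | hs
  · refine le_trans ?_ (far s hs h2 h3 h4)
    gcongr
    linarith
  set w : ℂ := ⟨1 + δ, s.im⟩
  have hw := far w le_rfl (by simp only [w]; linarith) h3 h4
  have hdiff : ‖riemannZeta w - riemannZeta s‖ ≤ D * T ^ θ * ‖w - s‖ := by
    refine Convex.norm_image_sub_le_of_norm_deriv_le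
      (s := {z : ℂ | z.re ∈ Icc (1 - δ) (1 + δ)} ∩ {z : ℂ | z.im ∈ Icc s.im s.im})
      (fun z hz => differentiableAt_riemannZeta ?_) (fun z hz => ?_) ?_ ?_ ?_
    · have : z.im = s.im := by simpa using hz.2
      rintro rfl
      rw [← this] at h3
      norm_num at h3
    · have hi : z.im = s.im := by simpa using hz.2
      have hr := hz.1
      simp only [mem_ofPred_eq, mem_Icc] at hr
      exact hD' T hT z (by linarith) (by linarith) (by rwa [hi]) (by rwa [hi])
    · exact ((convex_Icc _ _).linear_preimage reLm).inter
        ((convex_Icc _ _).linear_preimage imLm)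
    · exact ⟨⟨h1, hs.le⟩, by simp⟩
    · exact ⟨⟨by simp only [w]; linarith, le_rfl⟩, by simp [w]⟩
  have hws : ‖w - s‖ ≤ 2 * δ := by
    refine (norm_le_abs_re_add_abs_im _).trans ?_
    simp only [w, sub_re, sub_im, sub_self, abs_zero, add_zero]
    rw [abs_of_nonneg (by linarith)]
    linarith
  have hd2 : ‖riemannZeta w - riemannZeta s‖ ≤ 2 * D * κ * T ^ (-(7 * θ)) := by
    refine hdiff.trans ((mul_le_mul_of_nonneg_left hws (by positivity)).trans (le_of_eq ?_))
    rw [hδ, show -(7 * θ) = θ + -(8 * θ) by ring, Real.rpow_add hT0]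
    ring
  have := norm_sub_norm_le (riemannZeta w) (riemannZeta s)
  linarith

/-- The analytic function whose Dirichlet series has the coefficients `Λ(n) - 1`. -/
noncomputable def logDerivZetaSubZeta (s : ℂ) : ℂ :=
  -deriv riemannZeta s / riemannZeta s - riemannZeta s

lemma exists_norm_logDerivZetaSubZeta_le {θ : ℝ} (hθ : 0 < θ) (hθ1 : θ ≤ 1) :
    ∃ C > 0, ∃ κ > 0, κ ≤ θ / 4 ∧ ∀ T : ℝ, 1 ≤ T → ∀ s : ℂ,
      1 - κ * T ^ (-(8 * θ)) ≤ s.re → s.re ≤ 3 → 1 / 2 ≤ |s.im| → |s.im| ≤ 2 * T →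
        DifferentiableAt ℂ logDerivZetaSubZeta s ∧
        ‖logDerivZetaSubZeta s‖ ≤ C * T ^ (8 * θ) := by
  obtain ⟨c, hc, κ, hκ, hκ1, h⟩ := exists_le_norm_riemannZeta hθ hθ1
  obtain ⟨A, hA, hA'⟩ := exists_norm_riemannZeta_le_rpow hθ hθ1
  obtain ⟨D, hD, hD'⟩ := exists_norm_deriv_riemannZeta_le_rpow hθ hθ1
  refine ⟨D / c + A, by positivity, κ, hκ, hκ1, fun T hT s h1 h2 h3 h4 => ?_⟩
  have hT0 : 0 < T := by linarith
  have hlow := h T hT s h1 h2 h3 h4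
  have hs1 : s ≠ 1 := by rintro rfl; norm_num at h3
  have hpos : 0 < c * T ^ (-(7 * θ)) := by positivity
  have hne : riemannZeta s ≠ 0 := norm_pos_iff.1 (hpos.trans_le hlow)
  have hδκ : κ * T ^ (-(8 * θ)) ≤ κ :=
    mul_le_of_le_one_right hκ.le (Real.rpow_le_one_of_one_le_of_nonpos hT (by linarith))
  constructor
  · have han := analyticOn_riemannZeta s hs1
    exact ((han.deriv.differentiableAt.neg).div han.differentiableAt hne).sub
      han.differentiableAt
  · refine (norm_sub_le _ _).trans ?_
    rw [norm_div, norm_neg, add_mul]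
    have hz := hA' T hT s (by linarith) (by linarith) (by linarith) (by linarith)
    have hd := hD' T hT s (by linarith) h2 h3 h4
    refine add_le_add ?_ (hz.trans ?_)
    · calc _ ≤ D * T ^ θ / (c * T ^ (-(7 * θ))) := by gcongr
        _ = D / c * T ^ (8 * θ) := by
          rw [Real.rpow_neg hT0.le, show 8 * θ = θ + 7 * θ by ring, Real.rpow_add hT0]
          field_simp
    · have := Real.rpow_le_rpow_of_exponent_le hT (by linarith : θ ≤ 8 * θ)
      gcongr

lemma exists_norm_iteratedDeriv_le_of_one_le_im (k : ℕ) :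
    ∃ C > 0, ∀ s : ℂ, 1 ≤ s.re → s.re ≤ 2 → 1 ≤ |s.im| →
      ‖iteratedDeriv k logDerivZetaSubZeta s‖ ≤ C * |s.im| ^ (1 / 2 : ℝ) := by
  set θ : ℝ := 1 / (16 * (k + 1)) with hθd
  have hθ : 0 < θ := by positivity
  have hθ1 : θ ≤ 1 := by
    rw [hθd, div_le_one (by positivity)]
    linarith [k.cast_nonneg (α := ℝ)]
  obtain ⟨C, hC, κ, hκ, hκ1, h⟩ := exists_norm_logDerivZetaSubZeta_le hθ hθ1
  refine ⟨k.factorial * C / κ ^ k, by positivity, fun s h1 h2 h3 => ?_⟩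
  set T := |s.im|
  have hT0 : 0 < T := by linarith
  set r := κ * T ^ (-(8 * θ)) with hr
  have hr0 : 0 < r := by positivity
  have hrκ : r ≤ κ :=
    mul_le_of_le_one_right hκ.le (Real.rpow_le_one_of_one_le_of_nonpos h3 (by linarith))
  have hreg : ∀ z : ℂ, ‖z - s‖ ≤ r → DifferentiableAt ℂ logDerivZetaSubZeta z ∧
        ‖logDerivZetaSubZeta z‖ ≤ C * T ^ (8 * θ) := by
    intro z hz
    have a := abs_im_mem_of_norm_sub_le hz
    have b := re_mem_of_norm_sub_le hz
    exact h T h3 z (by linarith) (by linarith) (by linarith) (by linarith)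
  have := norm_iteratedDeriv_le_of_forall_mem_sphere_norm_le (f := logDerivZetaSubZeta) (c := s)
    (C := C * T ^ (8 * θ)) k hr0 ?_ fun z hz => (hreg z (mem_sphere_iff_norm.1 hz).le).2
  · refine this.trans (le_of_eq ?_)
    rw [hr, mul_pow, ← Real.rpow_natCast (T ^ _) k, ← Real.rpow_mul hT0.le,
      show -(8 * θ) * k = -(8 * θ * k) by ring, Real.rpow_neg hT0.le,
      show (1 / 2 : ℝ) = 8 * θ + 8 * θ * k by rw [hθd]; field_simp; ring, Real.rpow_add hT0]
    field_simp
  · refine DifferentiableOn.diffContOnCl fun z hz => ?_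
    rw [closure_ball _ hr0.ne', Metric.mem_closedBall, dist_eq_norm] at hz
    exact (hreg z hz).1.differentiableWithinAt

/-- The analytic continuation of `logDerivZetaSubZeta` to a neighbourhood of `1`. -/
lemma exists_analyticAt_eqOn_logDerivZetaSubZeta :
    ∃ G : ℂ → ℂ, (∀ s : ℂ, 1 ≤ s.re → AnalyticAt ℂ G s) ∧
      ∀ s : ℂ, 1 < s.re → G s = logDerivZetaSubZeta s := by
  set Z := DirichletCharacter.LFunctionTrivChar₁ 1
  have hd : Differentiable ℂ Z := DirichletCharacter.differentiable_LFunctionTrivChar₁ 1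
  have hZ : ∀ z ≠ 1, Z z = (z - 1) * riemannZeta z := by
    intro z hz
    simp only [Z]
    rw [DirichletCharacter.LFunctionTrivChar₁, Function.update_of_ne hz]
    simp [DirichletCharacter.LFunctionTrivChar, DirichletCharacter.LFunction_modOne_eq]
  have hZ1 : Z 1 = 1 := by simp [Z, DirichletCharacter.LFunctionTrivChar₁]
  have hZa : ∀ z, AnalyticAt ℂ Z z := fun z => hd.analyticAt z
  have hds : Differentiable ℂ (dslope Z 1) := by
    rw [← differentiableOn_univ]
    exact (Complex.differentiableOn_dslope univ_mem).2 hd.differentiableOn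
  refine ⟨fun s => -deriv Z s / Z s - dslope Z 1 s, fun s hs => ?_, fun s hs => ?_⟩
  · have hne : Z s ≠ 0 := by
      rcases eq_or_ne s 1 with rfl | h1
      · simp [hZ1]
      · rw [hZ s h1]
        exact mul_ne_zero (sub_ne_zero.2 h1) (riemannZeta_ne_zero_of_one_le_re hs)
    exact ((hZa s).deriv.neg.div (hZa s) hne).sub (hds.analyticAt s)
  · have h1 : s ≠ 1 := by rintro rfl; simp at hs
    have hs1 : s - 1 ≠ 0 := sub_ne_zero.2 h1
    have hζ := riemannZeta_ne_zero_of_one_le_re hs.le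
    have hder : deriv Z s = riemannZeta s + (s - 1) * deriv riemannZeta s := by
      have : Z =ᶠ[𝓝 s] fun z => (z - 1) * riemannZeta z := by
        filter_upwards [isOpen_ne.mem_nhds h1] with z hz using hZ z hz
      rw [this.deriv_eq, deriv_fun_mul (by fun_prop) (differentiableAt_riemannZeta h1)]
      simp
    simp only [logDerivZetaSubZeta]
    rw [hder, dslope_of_ne _ h1, slope_def_field, hZ s h1, hZ1]
    field_simp
    ring

/-- Every derivative of `logDerivZetaSubZeta` is `O(|t|^{1/2})` up to the line `Re s = 1`. -/
lemma exists_norm_iteratedDeriv_logDerivZetaSubZeta_le (k : ℕ) :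
    ∃ C > 0, ∀ s : ℂ, 1 < s.re → s.re ≤ 2 →
      ‖iteratedDeriv k logDerivZetaSubZeta s‖ ≤ C * (1 + |s.im|) ^ (1 / 2 : ℝ) := by
  obtain ⟨C, hC, h⟩ := exists_norm_iteratedDeriv_le_of_one_le_im k
  obtain ⟨G, hG, hGe⟩ := exists_analyticAt_eqOn_logDerivZetaSubZeta
  have hcomp : IsCompact (Icc (1 : ℝ) 2 ×ℂ Icc (-1 : ℝ) 1) := isCompact_Icc.reProdIm isCompact_Icc
  obtain ⟨M, hM⟩ := hcomp.exists_bound_of_continuousOn (f := iteratedDeriv k G) fun s hs =>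
    (((hG s hs.1.1).iterated_deriv k).continuousAt.congr
      (by rw [iteratedDeriv_eq_iterate])).continuousWithinAt
  refine ⟨C + |M|, by positivity, fun s h1 h2 => ?_⟩
  have hone : (1 : ℝ) ≤ (1 + |s.im|) ^ (1 / 2 : ℝ) :=
    Real.one_le_rpow (by linarith [abs_nonneg s.im]) (by norm_num)
  rw [add_mul]
  rcases le_or_gt 1 |s.im| with h3 | h3
  · calc _ ≤ C * |s.im| ^ (1 / 2 : ℝ) := h s h1.le h2 h3
      _ ≤ C * (1 + |s.im|) ^ (1 / 2 : ℝ) := by gcongr; linarith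
      _ ≤ _ := le_add_of_nonneg_right (by positivity)
  · have heq : iteratedDeriv k logDerivZetaSubZeta s = iteratedDeriv k G s := by
      refine Filter.EventuallyEq.iteratedDeriv_eq k ?_
      filter_upwards [(isOpen_lt continuous_const continuous_re).mem_nhds h1] with z hz
        using (hGe z hz).symm
    rw [heq]
    have := hM s ⟨⟨h1.le, h2⟩, abs_le.1 h3.le⟩
    calc _ ≤ |M| * 1 := by rw [mul_one]; exact this.trans (le_abs_self M)
      _ ≤ |M| * (1 + |s.im|) ^ (1 / 2 : ℝ) := by gcongr
      _ ≤ _ := le_add_of_nonneg_left (by positivity)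

lemma norm_inv_mul_add_one_le {σ : ℝ} (hσ : 1 ≤ σ) (y : ℝ) :
    ‖1 / ((σ + y * I : ℂ) * ((σ + y * I : ℂ) + 1))‖ ≤ 2 * (1 + |y|) ^ (-2 : ℝ) := by
  set s : ℂ := σ + y * I
  have hre : s.re = σ := by simp [s]
  have him : s.im = y := by simp [s]
  have h1 : (1 + |y|) ^ 2 / 2 ≤ ‖s‖ ^ 2 := by
    rw [← normSq_eq_norm_sq, normSq_apply, hre, him]
    nlinarith [sq_abs y, sq_nonneg (|y| - 1), abs_nonneg y]
  have h2 : ‖s‖ ^ 2 ≤ ‖s + 1‖ ^ 2 := by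
    rw [← normSq_eq_norm_sq, ← normSq_eq_norm_sq, normSq_apply, normSq_apply]
    simp only [add_re, one_re, add_im, one_im, add_zero, hre, him]
    nlinarith
  have h3 : ‖s‖ ≤ ‖s + 1‖ := le_of_sq_le_sq h2 (norm_nonneg _)
  have h4 : (1 + |y|) ^ 2 / 2 ≤ ‖s‖ * ‖s + 1‖ := by nlinarith [norm_nonneg s]
  have hp : 0 < (1 + |y|) ^ 2 / 2 := by positivity
  rw [norm_div, norm_one, norm_mul, Real.rpow_neg (by positivity), Real.rpow_two]
  calc 1 / (‖s‖ * ‖s + 1‖) ≤ 1 / ((1 + |y|) ^ 2 / 2) := by gcongr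
    _ = _ := by field_simp

lemma continuous_inv_mul_add_one {σ : ℝ} (hσ : 1 ≤ σ) :
    Continuous fun y : ℝ => 1 / ((σ + y * I : ℂ) * ((σ + y * I : ℂ) + 1)) := by
  refine continuous_const.div (by fun_prop) fun y => mul_ne_zero ?_ ?_ <;> intro h <;>
  · have := congrArg re h
    simp at this
    linarith

lemma integrable_one_add_abs_rpow {r : ℝ} (hr : 1 < r) :
    Integrable fun y : ℝ => (1 + |y|) ^ (-r) := by
  simpa using integrable_one_add_norm (E := ℝ) (μ := volume) (r := r) (by simpa using hr)

lemma integrable_inv_mul_add_one {σ : ℝ} (hσ : 1 ≤ σ) :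
    Integrable fun y : ℝ => 1 / ((σ + y * I : ℂ) * ((σ + y * I : ℂ) + 1)) :=
  ((integrable_one_add_abs_rpow one_lt_two).const_mul 2).mono'
    (continuous_inv_mul_add_one hσ).aestronglyMeasurable
    (.of_forall fun y => norm_inv_mul_add_one_le hσ y)

lemma max_one_sub_eq_integral {σ : ℝ} (hσ : 1 ≤ σ) {u : ℝ} (hu : 0 < u) :
    ((max (1 - u) 0 : ℝ) : ℂ) = (1 / (2 * Real.pi)) •
      ∫ y : ℝ, (u : ℂ) ^ (-(σ + y * I : ℂ)) • (1 / ((σ + y * I : ℂ) * ((σ + y * I : ℂ) + 1))) := by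
  set f : ℝ → ℂ := fun t => (Ioc (0 : ℝ) 1).indicator (fun _ => (1 : ℂ)) t -
    (Ioc (0 : ℝ) 1).indicator (fun t : ℝ => (t : ℂ) ^ (1 : ℂ)) t
  have hfu : ∀ t > 0, f t = ((max (1 - t) 0 : ℝ) : ℂ) := by
    intro t ht
    rcases le_or_gt t 1 with h1 | h1
    · simp [f, indicator_of_mem (show t ∈ Ioc (0 : ℝ) 1 from ⟨ht, h1⟩), h1]
    · simp [f, indicator_of_notMem (show t ∉ Ioc (0 : ℝ) 1 from fun h => by linarith [h.2]), h1.le]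
  have hm : ∀ s : ℂ, 0 < s.re → HasMellin f s (1 / (s * (s + 1))) := by
    intro s hs
    have h1 := hasMellin_one_Ioc hs
    have h2 := hasMellin_cpow_Ioc 1 (s := s) (by simp; linarith)
    have h3 := hasMellin_sub h1.1 h2.1
    rw [h1.2, h2.2] at h3
    have hs0 : s ≠ 0 := by rintro rfl; simp at hs
    have hs1 : s + 1 ≠ 0 := by
      intro h
      have := congrArg re h
      simp at this
      linarith
    have e : 1 / (s * (s + 1)) = 1 / s - 1 / (s + 1) := by
      field_simp
      ring
    rw [e]
    exact h3
  have hline : ∀ y : ℝ, mellin f (σ + y * I) = 1 / ((σ + y * I : ℂ) * ((σ + y * I : ℂ) + 1)) :=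
    fun y => (hm _ (by simp; linarith)).2
  rw [← hfu u hu, ← mellinInv_mellin_eq σ f hu (hm _ (by simp; linarith)).1 ?_ ?_, mellinInv]
  · simp only [hline]
  · simp only [VerticalIntegrable, hline]
    exact integrable_inv_mul_add_one hσ
  · have hc : Continuous fun t : ℝ => ((max (1 - t) 0 : ℝ) : ℂ) := by fun_prop
    exact hc.continuousAt.congr (by filter_upwards [lt_mem_nhds hu] with t ht using (hfu t ht).symm)

/-- Perron's formula with the kernel `1 / (s (s + 1))`. -/
lemma hasSum_mul_max_eq_integral {σ : ℝ} (hσ : 1 ≤ σ) {x : ℝ} (hx : 0 < x) {c : ℕ → ℂ}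
    (hc0 : c 0 = 0) (hc : LSeriesSummable c σ) :
    HasSum (fun n : ℕ => c n * ((max (1 - n / x) 0 : ℝ) : ℂ))
      ((1 / (2 * Real.pi)) • ∫ y : ℝ, (x : ℂ) ^ (σ + y * I : ℂ) * LSeries c (σ + y * I) *
        (1 / ((σ + y * I : ℂ) * ((σ + y * I : ℂ) + 1)))) := by
  set K : ℝ → ℂ := fun y => 1 / ((σ + y * I : ℂ) * ((σ + y * I : ℂ) + 1))
  set F : ℕ → ℝ → ℂ := fun n y => (x : ℂ) ^ (σ + y * I : ℂ) * LSeries.term c (σ + y * I) n * K y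
  have hF : ∀ n ≠ 0, ∀ y, F n y = c n * (((n / x : ℝ) : ℂ) ^ (-(σ + y * I : ℂ)) • K y) := by
    intro n hn y
    simp only [F, LSeries.term_of_ne_zero hn, smul_eq_mul]
    rw [div_eq_mul_inv (n : ℝ) x, ofReal_mul, mul_cpow_ofReal_nonneg (by positivity) (by positivity),
      ofReal_inv, inv_cpow _ _ (by rw [arg_ofReal_of_nonneg hx.le]; exact Real.pi_pos.ne),
      cpow_neg, cpow_neg, inv_inv, ofReal_natCast, div_eq_mul_inv]
    ring
  have hterm : ∀ n, c n * ((max (1 - n / x) 0 : ℝ) : ℂ) = (1 / (2 * Real.pi)) • ∫ y, F n y := by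
    intro n
    rcases eq_or_ne n 0 with rfl | hn
    · simp [F, hc0]
    · simp only [hF n hn]
      rw [integral_const_mul, max_one_sub_eq_integral hσ (by positivity), mul_smul_comm]
  have hnorm : ∀ n y, ‖F n y‖ = x ^ σ * ‖LSeries.term c σ n‖ * ‖K y‖ := by
    intro n y
    simp only [F, norm_mul, norm_cpow_eq_rpow_re_of_pos hx, LSeries.norm_term_eq]
    simp
  have hcont : ∀ n, Continuous (F n) := by
    intro n
    have hx' : (x : ℂ) ≠ 0 := by exact_mod_cast hx.ne'
    refine ((Continuous.const_cpow (by fun_prop) (.inl hx')).mul ?_).mul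
      (continuous_inv_mul_add_one hσ)
    rcases eq_or_ne n 0 with rfl | hn
    · simp only [LSeries.term_zero]; exact continuous_const
    · simp only [LSeries.term_of_ne_zero hn]
      have hn' : (n : ℂ) ≠ 0 := by exact_mod_cast hn
      refine continuous_const.div (Continuous.const_cpow (by fun_prop) (.inl hn')) fun y => ?_
      rw [Ne, cpow_eq_zero_iff]
      exact fun h => hn' h.1
  have hKint : Integrable K := integrable_inv_mul_add_one hσ
  have hint : ∀ n, Integrable (F n) := fun n =>
    (hKint.norm.const_mul (x ^ σ * ‖LSeries.term c σ n‖)).mono' (hcont n).aestronglyMeasurable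
      (.of_forall fun y => (hnorm n y).le)
  have hs : Summable fun n => ∫ y, ‖F n y‖ := by
    simp only [hnorm, integral_const_mul]
    exact (hc.norm.mul_left _).mul_right _
  have key := (hasSum_integral_of_summable_integral_norm hint hs).const_smul (1 / (2 * Real.pi))
  simp only [← hterm] at key
  have e : ∀ y : ℝ, ∑' n, F n y = (x : ℂ) ^ (σ + y * I : ℂ) * LSeries c (σ + y * I) * K y :=
    fun y => by simp only [F, tsum_mul_right, tsum_mul_left]; rfl
  simp only [e] at key
  exact key

open ArithmeticFunction in
lemma abscissaOfAbsConv_vonMangoldt_sub_one_le :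
    LSeries.abscissaOfAbsConv (fun n : ℕ => (vonMangoldt n : ℂ) - 1) ≤ (1 : ℝ) :=
  LSeries.abscissaOfAbsConv_le_of_forall_lt_LSeriesSummable fun y hy =>
    (LSeriesSummable_vonMangoldt (s := y) (by simpa using hy)).sub
      (LSeriesSummable_one_iff (s := y).2 (by simpa using hy))

open ArithmeticFunction in
lemma LSeries_vonMangoldt_sub_one {s : ℂ} (hs : 1 < s.re) :
    LSeries (fun n : ℕ => (vonMangoldt n : ℂ) - 1) s = logDerivZetaSubZeta s := by
  have := LSeries_sub (LSeriesSummable_vonMangoldt hs) (LSeriesSummable_one_iff.2 hs)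
  rw [LSeries_vonMangoldt_eq_deriv_riemannZeta_div hs, LSeries_one_eq_riemannZeta hs] at this
  exact this

lemma iterate_logMul_apply (f : ℕ → ℂ) (k n : ℕ) :
    LSeries.logMul^[k] f n = Complex.log n ^ k * f n := by
  induction k with
  | zero => simp
  | succ k ih => rw [Function.iterate_succ_apply', LSeries.logMul, ih]; ring

open ArithmeticFunction in
/-- The Cesàro means of `(log n)^k (Λ(n) - 1)` are bounded, for every `k ≥ 1`. -/
lemma exists_abs_sum_log_pow_mul_vonMangoldt_sub_one_le {k : ℕ} (hk : k ≠ 0) :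
    ∃ C > 0, ∀ x : ℝ, Real.exp 1 ≤ x →
      |∑ n ∈ Finset.Icc 0 ⌊x⌋₊, Real.log n ^ k * (vonMangoldt n - 1) * (x - n)| ≤ C * x ^ 2 := by
  obtain ⟨C, hC, h⟩ := exists_norm_iteratedDeriv_logDerivZetaSubZeta_le k
  set a : ℕ → ℂ := fun n : ℕ => (vonMangoldt n : ℂ) - 1
  set c : ℕ → ℂ := LSeries.logMul^[k] a
  have hcn : ∀ n, c n = ((Real.log n ^ k * (vonMangoldt n - 1) : ℝ) : ℂ) := by
    intro n
    simp only [c, iterate_logMul_apply, a]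
    push_cast
    rfl
  set J := ∫ y : ℝ, (1 + |y|) ^ (-(3 / 2) : ℝ)
  have hJ : 0 ≤ J := integral_nonneg fun y => by positivity
  refine ⟨1 / (2 * Real.pi) * (Real.exp 1 * (2 * C) * J) + 1, by positivity, fun x hx => ?_⟩
  have hx1 : 1 < x := (Real.one_lt_exp_iff.2 one_pos).trans_le hx
  have hx0 : 0 < x := by linarith
  have hlog : 1 ≤ Real.log x := by rwa [Real.le_log_iff_exp_le hx0]
  set σ := 1 + 1 / Real.log x
  have hσ1 : 1 < σ := by simp only [σ]; linarith [one_div_pos.2 (by linarith : 0 < Real.log x)]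
  have hσ2 : σ ≤ 2 := by
    have : 1 / Real.log x ≤ 1 := by rw [div_le_one (by linarith)]; exact hlog
    simp only [σ]; linarith
  have hxσ : x ^ σ = Real.exp 1 * x := by
    rw [Real.rpow_def_of_pos hx0, show Real.log x * σ = 1 + Real.log x by
      simp only [σ]; field_simp; ring, Real.exp_add, Real.exp_log hx0]
  have habs : ∀ s : ℂ, 1 < s.re → LSeries.abscissaOfAbsConv a < s.re := fun s hs =>
    abscissaOfAbsConv_vonMangoldt_sub_one_le.trans_lt (by exact_mod_cast hs)
  have hL : ∀ s : ℂ, 1 < s.re → s.re ≤ 2 → ‖LSeries c s‖ ≤ C * (1 + |s.im|) ^ (1 / 2 : ℝ) := by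
    intro s hs hs2
    refine le_trans (le_of_eq ?_) (h s hs hs2)
    have e : iteratedDeriv k logDerivZetaSubZeta s = iteratedDeriv k (LSeries a) s := by
      refine Filter.EventuallyEq.iteratedDeriv_eq k ?_
      filter_upwards [(isOpen_lt continuous_const continuous_re).mem_nhds hs] with z hz
        using (LSeries_vonMangoldt_sub_one hz).symm
    rw [e, LSeries_iteratedDeriv k (habs s hs)]
    simp [c]
  have hsum : LSeriesSummable c σ := by
    refine LSeriesSummable_of_abscissaOfAbsConv_lt_re ?_
    rw [LSeries.absicssaOfAbsConv_logPowMul]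
    exact habs _ (by simpa using hσ1)
  have hP := hasSum_mul_max_eq_integral hσ1.le hx0 (by simp [hcn, hk]) hsum
  have hbound : ‖∫ y : ℝ, (x : ℂ) ^ (σ + y * I : ℂ) * LSeries c (σ + y * I) *
        (1 / ((σ + y * I : ℂ) * ((σ + y * I : ℂ) + 1)))‖ ≤ Real.exp 1 * (2 * C) * J * x := by
    have hi : Integrable fun y : ℝ => Real.exp 1 * x * (2 * C) * (1 + |y|) ^ (-(3 / 2) : ℝ) :=
      (integrable_one_add_abs_rpow (by norm_num)).const_mul _
    refine (norm_integral_le_of_norm_le hi (.of_forall fun y => ?_)).trans (le_of_eq ?_)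
    · have hLy := hL (σ + y * I) (by simpa using hσ1) (by simpa using hσ2)
      rw [show (σ + y * I : ℂ).im = y by simp] at hLy
      rw [norm_mul, norm_mul, norm_cpow_eq_rpow_re_of_pos hx0,
        show (σ + y * I : ℂ).re = σ by simp, hxσ]
      calc _ ≤ Real.exp 1 * x * (C * (1 + |y|) ^ (1 / 2 : ℝ)) * (2 * (1 + |y|) ^ (-2 : ℝ)) := by
            gcongr
            exact norm_inv_mul_add_one_le hσ1.le y
        _ = _ := by
            rw [show (-(3 / 2) : ℝ) = 1 / 2 + -2 by norm_num, Real.rpow_add (by positivity)]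
            ring
    · rw [integral_const_mul]; ring
  have hfin : ∑ n ∈ Finset.Icc 0 ⌊x⌋₊, c n * ((max (1 - n / x) 0 : ℝ) : ℂ) = _ :=
    (hasSum_sum_of_ne_finset_zero fun n hn => ?_).unique hP
  swap
  · have : x ≤ n := by
      simp only [Finset.mem_Icc, zero_le, true_and, not_le] at hn
      exact (Nat.lt_of_floor_lt hn).le
    rw [max_eq_right, ofReal_zero, mul_zero]
    rw [sub_nonpos, one_le_div hx0]
    exact this
  have hreal : ∑ n ∈ Finset.Icc 0 ⌊x⌋₊, c n * ((max (1 - n / x) 0 : ℝ) : ℂ) =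
      ((∑ n ∈ Finset.Icc 0 ⌊x⌋₊, Real.log n ^ k * (vonMangoldt n - 1) * (x - n) : ℝ) : ℂ) / x := by
    rw [ofReal_sum, Finset.sum_div]
    refine Finset.sum_congr rfl fun n hn => ?_
    have hnx : (n : ℝ) ≤ x := (Nat.le_floor_iff hx0.le).1 (Finset.mem_Icc.1 hn).2
    rw [max_eq_left (by rw [sub_nonneg, div_le_one hx0]; exact hnx), hcn, ← ofReal_div,
      ← ofReal_mul]
    congr 1
    field_simp
  rw [hreal] at hfin
  have hfin2 := congrArg norm hfin
  rw [norm_div, norm_real, norm_real, Real.norm_eq_abs, Real.norm_of_nonneg hx0.le,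
    div_eq_iff hx0.ne', norm_smul, Real.norm_of_nonneg (by positivity)] at hfin2
  rw [hfin2]
  calc _ ≤ 1 / (2 * Real.pi) * (Real.exp 1 * (2 * C) * J * x) * x := by gcongr
    _ = 1 / (2 * Real.pi) * (Real.exp 1 * (2 * C) * J) * x ^ 2 := by ring
    _ ≤ _ := by gcongr; linarith

end

section

open Topology Set MeasureTheory

lemma Finset.Icc_zero_subset_of_floor_le {x y : ℝ} (hxy : x ≤ y) :
    Finset.Icc 0 ⌊x⌋₊ ⊆ Finset.Icc 0 ⌊y⌋₊ :=
  Finset.Icc_subset_Icc_right (Nat.floor_le_floor hxy)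

lemma mul_sum_le_sum_mul_sub {a : ℕ → ℝ} (ha : ∀ n, 0 ≤ a n) {x y : ℝ} (hx : 0 ≤ x) (hxy : x ≤ y) :
    (y - x) * ∑ n ∈ Finset.Icc 0 ⌊x⌋₊, a n ≤
      ∑ n ∈ Finset.Icc 0 ⌊y⌋₊, a n * (y - n) - ∑ n ∈ Finset.Icc 0 ⌊x⌋₊, a n * (x - n) := by
  have h1 : ∑ n ∈ Finset.Icc 0 ⌊x⌋₊, a n * (y - n) ≤ ∑ n ∈ Finset.Icc 0 ⌊y⌋₊, a n * (y - n) := by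
    refine Finset.sum_le_sum_of_subset_of_nonneg (Finset.Icc_zero_subset_of_floor_le hxy) ?_
    intro n hn _
    have := (Nat.le_floor_iff (hx.trans hxy)).1 (Finset.mem_Icc.1 hn).2
    exact mul_nonneg (ha n) (by linarith)
  refine le_trans (le_of_eq ?_) (sub_le_sub_right h1 _)
  rw [Finset.mul_sum, ← Finset.sum_sub_distrib]
  exact Finset.sum_congr rfl fun n _ => by ring

lemma sum_mul_sub_le_mul_sum {a : ℕ → ℝ} (ha : ∀ n, 0 ≤ a n) {x y : ℝ} (hxy : x ≤ y) :
    ∑ n ∈ Finset.Icc 0 ⌊y⌋₊, a n * (y - n) - ∑ n ∈ Finset.Icc 0 ⌊x⌋₊, a n * (x - n) ≤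
      (y - x) * ∑ n ∈ Finset.Icc 0 ⌊y⌋₊, a n := by
  have h1 : ∑ n ∈ Finset.Icc 0 ⌊y⌋₊, a n * (x - n) ≤ ∑ n ∈ Finset.Icc 0 ⌊x⌋₊, a n * (x - n) := by
    rw [← Finset.sum_sdiff (Finset.Icc_zero_subset_of_floor_le hxy)]
    refine add_le_of_nonpos_left (Finset.sum_nonpos fun n hn => ?_)
    have : x < n := by
      simp only [Finset.mem_sdiff, Finset.mem_Icc, zero_le, true_and, not_le] at hn
      exact Nat.lt_of_floor_lt hn.2
    exact mul_nonpos_of_nonneg_of_nonpos (ha n) (by linarith)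
  refine (sub_le_sub_left h1 _).trans (le_of_eq ?_)
  rw [Finset.mul_sum, ← Finset.sum_sub_distrib]
  exact Finset.sum_congr rfl fun n _ => by ring

lemma sum_log_pow_sub_le (k : ℕ) {x y : ℝ} (hx : 0 ≤ x) (hy : 1 ≤ y) (hxy : x ≤ y) :
    ∑ n ∈ Finset.Icc 0 ⌊y⌋₊, Real.log n ^ k - ∑ n ∈ Finset.Icc 0 ⌊x⌋₊, Real.log n ^ k ≤
      (y - x + 1) * Real.log y ^ k := by
  rw [← Finset.sum_sdiff (Finset.Icc_zero_subset_of_floor_le hxy), add_sub_cancel_right]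
  have hl : 0 ≤ Real.log y ^ k := pow_nonneg (Real.log_nonneg hy) k
  have h1 : ∀ n ∈ Finset.Icc 0 ⌊y⌋₊ \ Finset.Icc 0 ⌊x⌋₊, Real.log n ^ k ≤ Real.log y ^ k := by
    intro n hn
    simp only [Finset.mem_sdiff, Finset.mem_Icc, zero_le, true_and, not_le] at hn
    have hn1 : (0 : ℝ) < n := by exact_mod_cast (Nat.zero_le _).trans_lt hn.2
    have hny : (n : ℝ) ≤ y := (Nat.le_floor_iff (by linarith)).1 hn.1
    exact pow_le_pow_left₀ (Real.log_natCast_nonneg n) (Real.log_le_log hn1 hny) k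
  refine (Finset.sum_le_card_nsmul _ _ _ h1).trans ?_
  rw [nsmul_eq_mul]
  gcongr
  rw [Finset.card_sdiff_of_subset (Finset.Icc_zero_subset_of_floor_le hxy), Nat.card_Icc,
    Nat.card_Icc]
  have hf := Nat.floor_le_floor hxy
  rw [show ⌊y⌋₊ + 1 - 0 - (⌊x⌋₊ + 1 - 0) = ⌊y⌋₊ - ⌊x⌋₊ by omega, Nat.cast_sub hf]
  linarith [Nat.floor_le (hx.trans hxy), Nat.lt_floor_add_one x]

open ArithmeticFunction in
/-- Tauberian step: a bound for `∑ (log n)^(2m) (Λ(n) - 1)` deduced from its Cesàro means. -/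
lemma exists_abs_sum_log_pow_mul_vonMangoldt_sub_le {m : ℕ} (hm : m ≠ 0) :
    ∃ C > 0, ∀ x : ℝ, 6 ≤ x →
      |∑ n ∈ Finset.Icc 0 ⌊x⌋₊, Real.log n ^ (2 * m) * vonMangoldt n -
        ∑ n ∈ Finset.Icc 0 ⌊x⌋₊, Real.log n ^ (2 * m)| ≤ C * (x * Real.log x ^ m) := by
  obtain ⟨C, hC, hS⟩ := exists_abs_sum_log_pow_mul_vonMangoldt_sub_one_le (k := 2 * m) (by omega)
  refine ⟨(1 / 2 + (m : ℝ) ^ m) * 2 ^ (2 * m) + 10 * C, by positivity, fun x hx => ?_⟩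
  have hx0 : 0 < x := by linarith
  have he := Real.exp_one_lt_d9
  have hlog : 1 ≤ Real.log x := by rw [Real.le_log_iff_exp_le hx0]; linarith
  have hlog0 : 0 < Real.log x := by linarith
  set L := Real.log x
  have hLm : 1 ≤ L ^ m := one_le_pow₀ hlog
  set h := x / (2 * L ^ m)
  have hh0 : 0 < h := by positivity
  have hhx : h ≤ x / 2 := by
    simp only [h]
    gcongr
    linarith
  have hLx : L ^ m * h = x / 2 := by simp only [h]; field_simp
  have hlog2 : ∀ y : ℝ, 1 ≤ y → y ≤ 2 * x → Real.log y ^ (2 * m) ≤ 2 ^ (2 * m) * (L ^ m * L ^ m) := by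
    intro y hy1 hy
    have : Real.log y ≤ 2 * L := by
      refine (Real.log_le_log (by linarith) hy).trans ?_
      rw [Real.log_mul two_ne_zero hx0.ne']
      linarith [Real.log_le_log two_pos (by linarith : (2 : ℝ) ≤ x)]
    refine (pow_le_pow_left₀ (Real.log_nonneg hy1) this (2 * m)).trans (le_of_eq ?_)
    ring
  set b : ℕ → ℝ := fun n => Real.log n ^ (2 * m) * vonMangoldt n
  set w : ℕ → ℝ := fun n => Real.log n ^ (2 * m)
  have hw : ∀ n, 0 ≤ w n := fun n => pow_nonneg (Real.log_natCast_nonneg n) _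
  have hb : ∀ n, 0 ≤ b n := fun n => mul_nonneg (hw n) vonMangoldt_nonneg
  have hS' : ∀ y, x / 2 ≤ y → y ≤ 2 * x → |∑ n ∈ Finset.Icc 0 ⌊y⌋₊, b n * (y - n) -
      ∑ n ∈ Finset.Icc 0 ⌊y⌋₊, w n * (y - n)| ≤ C * y ^ 2 := by
    intro y hy _
    refine le_trans (le_of_eq ?_) (hS y (by linarith))
    rw [← Finset.sum_sub_distrib]
    congr 1
    exact Finset.sum_congr rfl fun n _ => by simp only [b, w]; ring
  have s0 := abs_le.1 (hS' x (by linarith) (by linarith))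
  have s1 := abs_le.1 (hS' (x + h) (by linarith) (by linarith))
  have s2 := abs_le.1 (hS' (x - h) (by linarith) (by linarith))
  have b1 := mul_sum_le_sum_mul_sub hb hx0.le (by linarith : x ≤ x + h)
  have b2 := sum_mul_sub_le_mul_sum hb (by linarith : x - h ≤ x)
  have w1 := sum_mul_sub_le_mul_sum hw (by linarith : x ≤ x + h)
  have w2 := mul_sum_le_sum_mul_sub hw (by linarith) (by linarith : x - h ≤ x)
  have d1 := sum_log_pow_sub_le (2 * m) hx0.le (by linarith) (by linarith : x ≤ x + h)
  have d2 := sum_log_pow_sub_le (2 * m) (by linarith) (by linarith) (by linarith : x - h ≤ x)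
  have l1 := hlog2 (x + h) (by linarith) (by linarith)
  have l2 := hlog2 x (by linarith) (by linarith)
  have hLx' : L ^ m ≤ (m : ℝ) ^ m * x := by
    have hm0 : (0 : ℝ) < m := by positivity
    have h1 : L ≤ x ^ (1 / m : ℝ) / (1 / m : ℝ) := Real.log_le_rpow_div hx0.le (by positivity)
    refine (pow_le_pow_left₀ hlog0.le h1 m).trans (le_of_eq ?_)
    rw [div_pow, ← Real.rpow_natCast, ← Real.rpow_mul hx0.le, one_div_mul_cancel hm0.ne',
      Real.rpow_one, one_div, inv_pow, div_inv_eq_mul, mul_comm]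
  have hd : (h + 1) * (2 ^ (2 * m) * (L ^ m * L ^ m)) ≤
      (1 / 2 + (m : ℝ) ^ m) * 2 ^ (2 * m) * (x * L ^ m) := by
    have : (h + 1) * L ^ m ≤ (1 / 2 + (m : ℝ) ^ m) * x := by linarith
    calc _ = (h + 1) * L ^ m * (2 ^ (2 * m) * L ^ m) := by ring
      _ ≤ (1 / 2 + (m : ℝ) ^ m) * x * (2 ^ (2 * m) * L ^ m) := by gcongr
      _ = _ := by ring
  have hd1 := (mul_le_mul_of_nonneg_left l1 (by linarith : 0 ≤ h + 1)).trans hd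
  have hd2 := (mul_le_mul_of_nonneg_left l2 (by linarith : 0 ≤ h + 1)).trans hd
  have hq : C * x ^ 2 = h * (2 * C * (x * L ^ m)) := by linear_combination (-2 * C * x) * hLx
  have hq1 : C * (x + h) ^ 2 ≤ 4 * (C * x ^ 2) := by
    rw [mul_left_comm]
    gcongr
    nlinarith
  have hq2 : C * (x - h) ^ 2 ≤ C * x ^ 2 := by
    gcongr <;> linarith
  set B := ∑ n ∈ Finset.Icc 0 ⌊x⌋₊, b n
  set W := ∑ n ∈ Finset.Icc 0 ⌊x⌋₊, w n
  have u1 : B ≤ ∑ n ∈ Finset.Icc 0 ⌊x + h⌋₊, w n + 10 * C * (x * L ^ m) := by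
    refine le_of_mul_le_mul_left ?_ hh0
    linarith
  have u2 : ∑ n ∈ Finset.Icc 0 ⌊x - h⌋₊, w n - 10 * C * (x * L ^ m) ≤ B := by
    refine le_of_mul_le_mul_left ?_ hh0
    linarith
  rw [add_sub_cancel_left] at d1
  rw [sub_sub_cancel] at d2
  rw [abs_le]
  constructor <;> linarith

lemma exists_log_pow_le_mul_rpow (k : ℕ) {ε : ℝ} (hε : 0 < ε) :
    ∃ C > 0, ∀ x : ℝ, 1 ≤ x → Real.log x ^ k ≤ C * x ^ ε := by
  rcases eq_or_ne k 0 with rfl | hk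
  · exact ⟨1, one_pos, fun x hx => by simpa using Real.one_le_rpow hx hε.le⟩
  have hδ : 0 < ε / k := by positivity
  refine ⟨1 / (ε / k) ^ k, by positivity, fun x hx => ?_⟩
  have h := pow_le_pow_left₀ (Real.log_nonneg hx) (Real.log_le_rpow_div (by linarith : 0 ≤ x) hδ) k
  refine h.trans (le_of_eq ?_)
  rw [div_pow, ← Real.rpow_natCast, ← Real.rpow_mul (by linarith), div_mul_cancel₀ _ (by positivity)]
  ring

lemma intervalIntegrable_log_pow (k : ℕ) {a b : ℝ} (ha : 0 < a) (hb : 0 < b) :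
    IntervalIntegrable (fun v => Real.log v ^ k) volume a b := by
  refine ContinuousOn.intervalIntegrable ?_
  refine (Real.continuousOn_log.mono fun v hv => ?_).pow k
  have := (lt_min ha hb).trans_le hv.1
  exact this.ne'

lemma abs_sum_log_pow_sub_integral_le {k : ℕ} (hk : k ≠ 0) {u : ℝ} (hu : Real.exp 1 ≤ u) :
    |∑ n ∈ Finset.Icc 0 ⌊u⌋₊, Real.log n ^ k - ∫ v in (2 : ℝ)..u, Real.log v ^ k| ≤
      2 * Real.log u ^ k := by
  have he := Real.exp_one_gt_d9
  have hu0 : 0 < u := by linarith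
  have hL : 1 ≤ Real.log u := by rwa [Real.le_log_iff_exp_le hu0]
  have hLk : 1 ≤ Real.log u ^ k := one_le_pow₀ hL
  set N := ⌊u⌋₊
  have hN1 : 1 ≤ N := Nat.le_floor (by norm_num; linarith)
  have hN1' : (1 : ℝ) ≤ N := by exact_mod_cast hN1
  have hNu : (N : ℝ) ≤ u := Nat.floor_le hu0.le
  have huN : u < N + 1 := Nat.lt_floor_add_one u
  have hmono : MonotoneOn (fun v => Real.log v ^ k) (Icc (1 : ℕ) N) := by
    intro a ha b _ hab
    have ha1 : (1 : ℝ) ≤ a := by simpa using ha.1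
    exact pow_le_pow_left₀ (Real.log_nonneg ha1) (Real.log_le_log (by linarith) hab) k
  have h1 := hmono.sum_le_integral_Ico hN1
  have h2 := hmono.integral_le_sum_Ico hN1
  have e1 : ∑ n ∈ Finset.Icc 0 N, Real.log n ^ k =
      ∑ n ∈ Finset.Ico 1 N, Real.log n ^ k + Real.log N ^ k := by
    rw [← Finset.sum_Ico_succ_top hN1, ← Finset.sum_sdiff (s₁ := Finset.Ico 1 (N + 1))]
    · rw [add_eq_right]
      refine Finset.sum_eq_zero fun n hn => ?_
      have : n = 0 := by
        simp only [Finset.mem_sdiff, Finset.mem_Icc, Finset.mem_Ico] at hn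
        omega
      simp [this, hk]
    · intro n hn
      simp only [Finset.mem_Icc, Finset.mem_Ico] at hn ⊢
      omega
  have e2 : ∑ n ∈ Finset.Icc 0 N, Real.log n ^ k =
      ∑ n ∈ Finset.Ico 1 N, Real.log (n + 1 : ℕ) ^ k := by
    rw [Finset.sum_Ico_add' (fun n : ℕ => Real.log n ^ k) 1 N 1,
      ← Finset.sum_sdiff (s₁ := Finset.Ico (1 + 1) (N + 1))]
    · rw [add_eq_right]
      refine Finset.sum_eq_zero fun n hn => ?_
      have : n = 0 ∨ n = 1 := by
        simp only [Finset.mem_sdiff, Finset.mem_Icc, Finset.mem_Ico] at hn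
        omega
      rcases this with rfl | rfl <;> simp [hk]
    · intro n hn
      simp only [Finset.mem_Icc, Finset.mem_Ico] at hn ⊢
      omega
  have hlogN : Real.log N ^ k ≤ Real.log u ^ k :=
    pow_le_pow_left₀ (Real.log_natCast_nonneg N) (Real.log_le_log (by linarith) hNu) k
  rw [← e2] at h2
  simp only [Nat.cast_one] at h1 h2
  have i1 := intervalIntegral.integral_add_adjacent_intervals
    (intervalIntegrable_log_pow k one_pos two_pos) (intervalIntegrable_log_pow k two_pos hu0)
  have i2 := intervalIntegral.integral_add_adjacent_intervals
    (intervalIntegrable_log_pow k one_pos (by linarith))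
    (intervalIntegrable_log_pow k (by linarith : 0 < (N : ℝ)) hu0)
  have bound : ∀ a b c : ℝ, 1 ≤ a → a ≤ b → b ≤ a + 1 → Real.log b ^ k ≤ c → 0 ≤ c →
      0 ≤ ∫ v in a..b, Real.log v ^ k ∧ ∫ v in a..b, Real.log v ^ k ≤ c := by
    intro a b c ha hab hb hc hc0
    constructor
    · exact intervalIntegral.integral_nonneg hab fun v hv =>
        pow_nonneg (Real.log_nonneg (ha.trans hv.1)) k
    · have := intervalIntegral.integral_mono_on (μ := volume) hab
        (intervalIntegrable_log_pow k (by linarith) (by linarith)) intervalIntegrable_const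
        (g := fun _ => c) fun v hv => (pow_le_pow_left₀ (Real.log_nonneg (ha.trans hv.1))
          (Real.log_le_log (by linarith [hv.1]) hv.2) k).trans hc
      rw [intervalIntegral.integral_const, smul_eq_mul] at this
      nlinarith
  have b1 := bound 1 2 1 le_rfl one_le_two (by norm_num)
    (pow_le_one₀ (Real.log_nonneg one_le_two) (by linarith [Real.log_two_lt_d9])) zero_le_one
  have b2 := bound N u _ hN1' hNu huN.le le_rfl (by linarith)
  rw [abs_le]
  constructor <;> linarith [b1.1, b1.2, b2.1, b2.2]

open ArithmeticFunction in
lemma sum_log_pow_mul_vonMangoldt_sub_sum_prime_le (k : ℕ) {u : ℝ} (hu : 1 ≤ u) :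
    |∑ n ∈ Finset.Icc 0 ⌊u⌋₊, Real.log n ^ k * vonMangoldt n -
      ∑ n ∈ Finset.Icc 0 ⌊u⌋₊, if n.Prime then Real.log n ^ (k + 1) else 0| ≤
        2 * √u * Real.log u ^ (k + 1) := by
  have hL := Real.log_nonneg hu
  have h0 := Chebyshev.psi_sub_theta_le hu
  have e : ∑ n ∈ Finset.Icc 0 ⌊u⌋₊, Real.log n ^ k * vonMangoldt n -
      ∑ n ∈ Finset.Icc 0 ⌊u⌋₊, (if n.Prime then Real.log n ^ (k + 1) else 0) =
      ∑ n ∈ Finset.Ioc 0 ⌊u⌋₊ with ¬ n.Prime, Real.log n ^ k * vonMangoldt n := by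
    rw [← Finset.sum_sub_distrib, Finset.sum_filter,
      ← Finset.sum_subset (Finset.Ioc_subset_Icc_self)]
    · refine Finset.sum_congr rfl fun n _ => ?_
      by_cases hp : n.Prime
      · simp [hp, vonMangoldt_apply_prime hp, pow_succ]
      · simp [hp]
    · intro n h1 h2
      have : n = 0 := by
        simp only [Finset.mem_Icc, Finset.mem_Ioc] at h1 h2
        omega
      simp [this]
  rw [Chebyshev.psi_sub_theta_eq_sum_not_prime] at h0
  rw [e, abs_of_nonneg (Finset.sum_nonneg fun n _ =>
    mul_nonneg (pow_nonneg (Real.log_natCast_nonneg n) k) vonMangoldt_nonneg)]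
  calc _ ≤ ∑ n ∈ Finset.Ioc 0 ⌊u⌋₊ with ¬ n.Prime, Real.log u ^ k * vonMangoldt n := by
        refine Finset.sum_le_sum fun n hn => ?_
        simp only [Finset.mem_filter, Finset.mem_Ioc] at hn
        have hn1 : (0 : ℝ) < n := by exact_mod_cast hn.1.1
        have hnu : (n : ℝ) ≤ u := (Nat.le_floor_iff (by linarith)).1 hn.1.2
        have := Real.log_natCast_nonneg n
        gcongr
    _ ≤ Real.log u ^ k * (2 * √u * Real.log u) := by
        rw [← Finset.mul_sum]
        gcongr
    _ = _ := by ring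

/-- The prime number theorem with error term, in the weighted form
`∑_{p ≤ u} (log p)^(2m+1) = ∫_2^u (log v)^(2m) dv + O(u (log u)^m)`. -/
lemma exists_abs_sum_prime_log_pow_sub_integral_le {m : ℕ} (hm : m ≠ 0) :
    ∃ C > 0, ∀ u : ℝ, 2 ≤ u →
      |(∑ n ∈ Finset.Icc 0 ⌊u⌋₊, if n.Prime then Real.log n ^ (2 * m + 1) else 0) -
        ∫ v in (2 : ℝ)..u, Real.log v ^ (2 * m)| ≤ C * (u * Real.log u ^ m) := by
  obtain ⟨C₁, hC₁, h₁⟩ := exists_abs_sum_log_pow_mul_vonMangoldt_sub_le hm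
  obtain ⟨C₂, hC₂, h₂⟩ := exists_log_pow_le_mul_rpow (m + 1) (ε := 1 / 2) (by norm_num)
  obtain ⟨C₃, hC₃, h₃⟩ := exists_log_pow_le_mul_rpow m one_pos
  set T : ℝ → ℝ := fun u =>
    ∑ n ∈ Finset.Icc 0 ⌊u⌋₊, if n.Prime then Real.log n ^ (2 * m + 1) else 0
  set J : ℝ → ℝ := fun u => ∫ v in (2 : ℝ)..u, Real.log v ^ (2 * m)
  have hT : ∀ u, 0 ≤ T u := fun u => Finset.sum_nonneg fun n _ => by
    split_ifs
    · exact pow_nonneg (Real.log_natCast_nonneg n) _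
    · rfl
  have hTm : ∀ u ≤ 6, T u ≤ T 6 := fun u hu =>
    Finset.sum_le_sum_of_subset_of_nonneg (Finset.Icc_zero_subset_of_floor_le hu) fun n _ _ => by
      split_ifs
      · exact pow_nonneg (Real.log_natCast_nonneg n) _
      · rfl
  have hpos : ∀ a b : ℝ, 2 ≤ a → a ≤ b → 0 ≤ ∫ v in a..b, Real.log v ^ (2 * m) :=
    fun a b ha hab => intervalIntegral.integral_nonneg hab fun v hv =>
      pow_nonneg (Real.log_nonneg (by linarith [hv.1])) _
  have hl2 : 0 < Real.log 2 := Real.log_pos one_lt_two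
  set c := 2 * Real.log 2 ^ m
  have hc : 0 < c := by positivity
  have hJ6 : 0 ≤ J 6 := hpos 2 6 le_rfl (by norm_num)
  refine ⟨C₁ + 2 * C₂ + 2 * C₃ + (T 6 + J 6) / c, by have := hT 6; positivity, fun u hu => ?_⟩
  have hu0 : 0 < u := by linarith
  have hlog : Real.log 2 ≤ Real.log u := Real.log_le_log two_pos hu
  have hlog0 : 0 < Real.log u := by linarith
  rcases le_or_gt 6 u with h6 | h6
  · have hs := h₁ u h6
    have hp := sum_log_pow_mul_vonMangoldt_sub_sum_prime_le (2 * m) (by linarith : 1 ≤ u)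
    have hi := abs_sum_log_pow_sub_integral_le (k := 2 * m) (by omega)
      (by linarith [Real.exp_one_lt_d9] : Real.exp 1 ≤ u)
    have p1 : 2 * √u * Real.log u ^ (2 * m + 1) ≤ 2 * C₂ * (u * Real.log u ^ m) := by
      have := h₂ u (by linarith)
      rw [← Real.sqrt_eq_rpow] at this
      calc _ = 2 * √u * Real.log u ^ m * Real.log u ^ (m + 1) := by ring
        _ ≤ 2 * √u * Real.log u ^ m * (C₂ * √u) := by gcongr
        _ = 2 * C₂ * ((√u * √u) * Real.log u ^ m) := by ring
        _ = _ := by rw [Real.mul_self_sqrt hu0.le]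
    have p2 : 2 * Real.log u ^ (2 * m) ≤ 2 * C₃ * (u * Real.log u ^ m) := by
      have := h₃ u (by linarith)
      rw [Real.rpow_one] at this
      calc _ = 2 * Real.log u ^ m * Real.log u ^ m := by ring
        _ ≤ 2 * Real.log u ^ m * (C₃ * u) := by gcongr
        _ = _ := by ring
    have p3 : 0 ≤ (T 6 + J 6) / c * (u * Real.log u ^ m) := by have := hT 6; positivity
    rw [abs_le] at hs hp hi ⊢
    constructor <;> linarith [hs.1, hs.2, hp.1, hp.2, hi.1, hi.2]
  · have q : c ≤ u * Real.log u ^ m := by simp only [c]; gcongr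
    have hJu : J u ≤ J 6 := by
      have := intervalIntegral.integral_add_adjacent_intervals
        (intervalIntegrable_log_pow (2 * m) two_pos hu0)
        (intervalIntegrable_log_pow (2 * m) hu0 (by norm_num : (0 : ℝ) < 6))
      have := hpos u 6 hu h6.le
      linarith
    have hJ0 : 0 ≤ J u := hpos 2 u le_rfl hu
    have p3 : T 6 + J 6 ≤ (T 6 + J 6) / c * (u * Real.log u ^ m) := by
      have := hT 6
      calc _ = (T 6 + J 6) / c * c := by field_simp
        _ ≤ _ := by gcongr
    have p4 : 0 ≤ (C₁ + 2 * C₂ + 2 * C₃) * (u * Real.log u ^ m) := by positivity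
    have := hTm u h6.le
    have := hT u
    rw [abs_le]
    constructor <;> linarith

lemma hasDerivAt_ofReal_cpow (s : ℂ) {u : ℝ} (hu : 0 < u) :
    HasDerivAt (fun v : ℝ => (v : ℂ) ^ s) (s * (u : ℂ) ^ (s - 1)) u := by
  have := (hasDerivAt_id (u : ℂ)).cpow_const (c := s) (Or.inl (by simpa using hu))
  simpa using this.comp_ofReal

lemma hasDerivAt_cpow_div_log_pow (s : ℂ) (k : ℕ) {u : ℝ} (hu : 1 < u) :
    HasDerivAt (fun v : ℝ => (v : ℂ) ^ s / (Real.log v : ℂ) ^ k)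
      ((u : ℂ) ^ (s - 1) * (s / (Real.log u : ℂ) ^ k - k / (Real.log u : ℂ) ^ (k + 1))) u := by
  have hu0 : 0 < u := by linarith
  have hL : (Real.log u : ℂ) ≠ 0 := by exact_mod_cast (Real.log_pos hu).ne'
  have hu' : (u : ℂ) ≠ 0 := by exact_mod_cast hu0.ne'
  have h1 := ((Real.hasDerivAt_log hu0.ne').ofReal_comp).fun_pow k
  refine ((hasDerivAt_ofReal_cpow s hu0).fun_div h1 (pow_ne_zero k hL)).congr_deriv ?_
  rw [show (u : ℂ) ^ s = (u : ℂ) ^ (s - 1) * u by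
    rw [Complex.cpow_sub _ _ hu', Complex.cpow_one, div_mul_cancel₀ _ hu']]
  rcases k with _ | k
  · simp; ring
  · push_cast
    field_simp
    ring

lemma continuousOn_cpow_mul_log_pow (s a b : ℂ) (k l : ℕ) :
    ContinuousOn (fun u : ℝ => (u : ℂ) ^ s * (a / (Real.log u : ℂ) ^ k - b / (Real.log u : ℂ) ^ l))
      (Ioi 1) := by
  intro u hu
  have hu1 : (1 : ℝ) < u := hu
  have hu0 : 0 < u := by linarith
  have hL : (Real.log u : ℂ) ≠ 0 := by exact_mod_cast (Real.log_pos hu1).ne'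
  have h1 := ((Real.hasDerivAt_log hu0.ne').ofReal_comp).continuousAt
  exact ((hasDerivAt_ofReal_cpow s hu0).continuousAt.mul
    ((continuousAt_const.div (h1.pow k) (pow_ne_zero k hL)).sub
      (continuousAt_const.div (h1.pow l) (pow_ne_zero l hL)))).continuousWithinAt

lemma exists_rpow_div_log_pow_le {β : ℝ} (hβ : 0 < β) (r : ℕ) :
    ∃ C > 0, ∀ u x : ℝ, 2 ≤ u → u ≤ x →
      u ^ β / Real.log u ^ r ≤ C * (x ^ β / Real.log x ^ r) := by
  obtain ⟨C, hC, h⟩ : ∃ C > 0, ∀ w : ℝ, 1 ≤ w → (1 + 2 * Real.log w) ^ r ≤ C * w ^ β := by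
    have hδ : 0 < β / (r + 1) := by positivity
    refine ⟨(1 + 2 * (1 / (β / (r + 1)))) ^ r, by positivity, fun w hw => ?_⟩
    have h1 := Real.log_le_rpow_div (by linarith : 0 ≤ w) hδ
    have h2 := Real.one_le_rpow hw hδ.le
    have h3 := Real.log_nonneg hw
    calc (1 + 2 * Real.log w) ^ r
        ≤ ((1 + 2 * (1 / (β / (r + 1)))) * w ^ (β / (r + 1))) ^ r := by
          gcongr
          rw [div_eq_mul_one_div] at h1
          linarith
      _ = (1 + 2 * (1 / (β / (r + 1)))) ^ r * w ^ (β / (r + 1) * r) := by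
          rw [mul_pow, ← Real.rpow_natCast (w ^ _), ← Real.rpow_mul (by linarith)]
      _ ≤ _ := by
          gcongr
          rw [div_mul_eq_mul_div, div_le_iff₀ (by positivity)]
          nlinarith
  refine ⟨C, hC, fun u x hu hux => ?_⟩
  have hu0 : 0 < u := by linarith
  have hx0 : 0 < x := by linarith
  have hlu : 1 / 2 ≤ Real.log u :=
    (by linarith [Real.log_two_gt_d9] : 1 / 2 ≤ Real.log 2).trans (Real.log_le_log two_pos hu)
  have hlu0 : 0 < Real.log u := by linarith
  have hlx0 : 0 < Real.log x := hlu0.trans_le (Real.log_le_log hu0 hux)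
  have hw := h (x / u) (by rwa [one_le_div hu0])
  have hw0 : 0 ≤ Real.log (x / u) := Real.log_nonneg (by rwa [one_le_div hu0])
  have hlog : Real.log x ≤ Real.log u * (1 + 2 * Real.log (x / u)) := by
    have : Real.log x = Real.log u + Real.log (x / u) := by
      rw [Real.log_div hx0.ne' hu0.ne']; ring
    nlinarith
  rw [Real.div_rpow hx0.le hu0.le] at hw
  have hlogr : Real.log x ^ r ≤ Real.log u ^ r * (C * (x ^ β / u ^ β)) := by
    refine (pow_le_pow_left₀ hlx0.le hlog r).trans ?_
    rw [mul_pow]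
    gcongr
  rw [mul_div_assoc', div_le_div_iff₀ (by positivity) (by positivity)]
  calc _ ≤ u ^ β * (Real.log u ^ r * (C * (x ^ β / u ^ β))) := by gcongr
    _ = _ := by
      have : u ^ β ≠ 0 := by positivity
      field_simp

lemma norm_cpow_mul_log_pow_le (s : ℂ) (k : ℕ) {u : ℝ} (hu : 2 ≤ u) :
    ‖(u : ℂ) ^ (s - 1) * (s / (Real.log u : ℂ) ^ k - k / (Real.log u : ℂ) ^ (k + 1))‖ ≤
      (‖s‖ + 2 * k) * (u ^ (s.re - 1) / Real.log u ^ k) := by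
  have hu0 : 0 < u := by linarith
  have hlu : 1 / 2 ≤ Real.log u :=
    (by linarith [Real.log_two_gt_d9] : 1 / 2 ≤ Real.log 2).trans (Real.log_le_log two_pos hu)
  have hlu0 : 0 < Real.log u := by linarith
  rw [norm_mul, Complex.norm_cpow_eq_rpow_re_of_pos hu0, Complex.sub_re, Complex.one_re]
  have h1 : ‖s / (Real.log u : ℂ) ^ k - k / (Real.log u : ℂ) ^ (k + 1)‖ ≤
      (‖s‖ + 2 * k) / Real.log u ^ k := by
    refine (norm_sub_le _ _).trans ?_
    rw [norm_div, norm_div, norm_pow, norm_pow, Complex.norm_real, Complex.norm_natCast,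
      Real.norm_of_nonneg hlu0.le, add_div]
    refine add_le_add le_rfl ?_
    rw [div_le_div_iff₀ (by positivity) (by positivity), pow_succ]
    have : 0 ≤ (k : ℝ) * Real.log u ^ k := by positivity
    nlinarith
  calc _ ≤ u ^ (s.re - 1) * ((‖s‖ + 2 * k) / Real.log u ^ k) := by gcongr
    _ = _ := by ring

lemma exists_norm_integral_cpow_mul_le {s : ℂ} (hs : -1 < s.re) (m : ℕ) {C : ℝ} (hC : 0 < C)
    {E : ℝ → ℝ} (hE : ∀ u, 2 ≤ u → |E u| ≤ C * (u * Real.log u ^ m)) :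
    ∃ D > 0, ∀ x : ℝ, 2 ≤ x →
      ‖∫ u in (2 : ℝ)..x, (u : ℂ) ^ (s - 1) * (s / (Real.log u : ℂ) ^ (2 * m + 1) -
        (2 * m + 1 : ℕ) / (Real.log u : ℂ) ^ (2 * m + 1 + 1)) * E u‖ ≤
        D * (x ^ (s.re + 1) / Real.log x ^ (m + 1)) := by
  set β := (s.re + 1) / 2
  have hβ : 0 < β := by simp only [β]; linarith
  obtain ⟨K, hK, hg⟩ := exists_rpow_div_log_pow_le hβ (m + 1)
  set A := ‖s‖ + 2 * (2 * m + 1 : ℕ)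
  have hA : 0 < A := by positivity
  refine ⟨A * C * K * (1 / β), by positivity, fun x hx => ?_⟩
  have hx0 : 0 < x := by linarith
  have hlx0 : 0 < Real.log x := Real.log_pos (by linarith)
  set B := A * C * K * (x ^ β / Real.log x ^ (m + 1))
  have hB : 0 < B := by positivity
  have hi : IntervalIntegrable (fun u : ℝ => B * u ^ (β - 1)) volume 2 x :=
    (intervalIntegral.intervalIntegrable_rpow' (by linarith)).const_mul B
  refine (intervalIntegral.norm_integral_le_of_norm_le hx (.of_forall fun u hu => ?_) hi).trans ?_
  · have hu2 : 2 ≤ u := hu.1.le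
    have hu0 : 0 < u := by linarith
    have hlu0 : 0 < Real.log u := Real.log_pos (by linarith)
    rw [norm_mul, Complex.norm_real, Real.norm_eq_abs]
    have h1 := norm_cpow_mul_log_pow_le s (2 * m + 1) hu2
    calc _ ≤ A * (u ^ (s.re - 1) / Real.log u ^ (2 * m + 1)) * (C * (u * Real.log u ^ m)) := by
          gcongr
          exact hE u hu2
      _ = A * C * (u ^ β / Real.log u ^ (m + 1)) * u ^ (β - 1) := by
          have e1 : u ^ (s.re - 1) * u = u ^ β * u ^ (β - 1) := by
            rw [← Real.rpow_add hu0, ← Real.rpow_add_one hu0.ne']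
            congr 1
            simp only [β]; ring
          have e2 : Real.log u ^ (2 * m + 1) = Real.log u ^ m * Real.log u ^ (m + 1) := by ring
          rw [e2]
          field_simp
          linear_combination e1
      _ ≤ A * C * (K * (x ^ β / Real.log x ^ (m + 1))) * u ^ (β - 1) := by
          gcongr
          exact hg u x hu2 hu.2
      _ = _ := by ring
  · rw [intervalIntegral.integral_const_mul, integral_rpow (.inl (by linarith)), sub_add_cancel]
    calc _ ≤ B * (x ^ β / β) := by
          gcongr
          exact sub_le_self _ (by positivity)
      _ = A * C * K * (1 / β) * (x ^ β * x ^ β / Real.log x ^ (m + 1)) := by ring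
      _ = _ := by
          rw [← Real.rpow_add hx0, show β + β = s.re + 1 by simp only [β]; ring]

lemma exists_norm_sum_prime_cpow_sub_integral_le {s : ℂ} (hs : -1 < s.re) {m : ℕ} (hm : m ≠ 0) :
    ∃ C > 0, ∀ x : ℝ, 2 ≤ x →
      ‖∑ n ∈ Finset.Icc 0 ⌊x⌋₊, (if n.Prime then (n : ℂ) ^ s else 0) -
        ∫ u in (2 : ℝ)..x, (u : ℂ) ^ s / Real.log u‖ ≤
        C * (x ^ (s.re + 1) / Real.log x ^ (m + 1)) := by
  obtain ⟨C, hC, hE⟩ := exists_abs_sum_prime_log_pow_sub_integral_le hm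
  set c : ℕ → ℝ := fun n => if n.Prime then Real.log n ^ (2 * m + 1) else 0
  set T : ℝ → ℝ := fun u => ∑ n ∈ Finset.Icc 0 ⌊u⌋₊, c n
  set J : ℝ → ℝ := fun u => ∫ v in (2 : ℝ)..u, Real.log v ^ (2 * m)
  obtain ⟨D, hD, hint⟩ := exists_norm_integral_cpow_mul_le hs m hC (E := fun u => T u - J u) hE
  set f : ℝ → ℂ := fun u => (u : ℂ) ^ s / (Real.log u : ℂ) ^ (2 * m + 1)
  set f' : ℝ → ℂ := fun u => (u : ℂ) ^ (s - 1) * (s / (Real.log u : ℂ) ^ (2 * m + 1) -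
        (2 * m + 1 : ℕ) / (Real.log u : ℂ) ^ (2 * m + 1 + 1))
  refine ⟨C + D, by positivity, fun x hx => ?_⟩
  have hx0 : 0 < x := by linarith
  have hlx0 : 0 < Real.log x := Real.log_pos (by linarith)
  have hf : ∀ u : ℝ, 1 < u → HasDerivAt f (f' u) u := fun u hu =>
    hasDerivAt_cpow_div_log_pow s (2 * m + 1) hu
  have hf'c : ContinuousOn f' (Icc 2 x) :=
    (continuousOn_cpow_mul_log_pow _ _ _ _ _).mono fun u hu => by
      simp only [mem_Ioi]; linarith [hu.1]
  have hf'i : IntervalIntegrable f' volume 2 x := by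
    refine ContinuousOn.intervalIntegrable ?_
    rwa [uIcc_of_le hx]
  have hderiv : ∀ u ∈ Icc 2 x, deriv f u = f' u := fun u hu => (hf u (by linarith [hu.1])).deriv
  have hsum : ∑ n ∈ Finset.Icc 0 ⌊x⌋₊, (if n.Prime then (n : ℂ) ^ s else 0) =
      f x * T x - ∫ u in (2 : ℝ)..x, f' u * T u := by
    have := sum_mul_eq_sub_integral_mul₁ (𝕜 := ℂ) (fun n => (c n : ℂ)) (f := f) (by simp [c])
      (by simp [c]) x (fun u hu => (hf u (by linarith [hu.1])).differentiableAt)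
      ((hf'c.congr hderiv).integrableOn_Icc)
    rw [intervalIntegral.integral_of_le hx]
    simp only [T, Complex.ofReal_sum]
    rw [setIntegral_congr_fun measurableSet_Ioc
      (g := fun u => f' u * ∑ n ∈ Finset.Icc 0 ⌊u⌋₊, (c n : ℂ))
      fun u hu => by simp only [hderiv u (Ioc_subset_Icc_self hu)]] at this
    rw [← this]
    refine Finset.sum_congr rfl fun n _ => ?_
    simp only [f, c]
    split_ifs with hp
    · have : (Real.log n : ℂ) ≠ 0 := by
        exact_mod_cast (Real.log_pos (by exact_mod_cast hp.one_lt)).ne'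
      rw [Complex.ofReal_pow, div_mul_cancel₀ _ (pow_ne_zero _ this), Complex.ofReal_natCast]
    · simp
  have hJd : ∀ u ∈ uIcc 2 x, HasDerivAt (fun u => (J u : ℂ)) ((Real.log u ^ (2 * m) : ℝ) : ℂ) u := by
    intro u hu
    rw [uIcc_of_le hx] at hu
    have hu0 : 0 < u := by linarith [hu.1]
    have hc : ContinuousOn (fun v : ℝ => Real.log v ^ (2 * m)) (Ioi 0) :=
      (Real.continuousOn_log.mono fun v hv => (show (0 : ℝ) < v from hv).ne').pow _
    exact (intervalIntegral.integral_hasDerivAt_right (intervalIntegrable_log_pow _ two_pos hu0)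
      (hc.stronglyMeasurableAtFilter isOpen_Ioi u hu0)
      (hc.continuousAt (Ioi_mem_nhds hu0))).ofReal_comp
  have hJc : ContinuousOn (fun u => (J u : ℂ)) (uIcc 2 x) := fun u hu =>
    (hJd u hu).continuousAt.continuousWithinAt
  have hparts : ∫ u in (2 : ℝ)..x, (u : ℂ) ^ s / Real.log u =
      f x * J x - ∫ u in (2 : ℝ)..x, f' u * J u := by
    have := intervalIntegral.integral_mul_deriv_eq_deriv_mul (a := 2) (b := x) (u := f) (u' := f')
      (fun u hu => hf u (by rw [uIcc_of_le hx] at hu; linarith [hu.1])) hJd hf'i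
      ⟨(intervalIntegrable_log_pow _ two_pos hx0).1.ofReal,
        (intervalIntegrable_log_pow _ two_pos hx0).2.ofReal⟩
    rw [show J 2 = 0 from intervalIntegral.integral_same, Complex.ofReal_zero, mul_zero,
      sub_zero] at this
    rw [← this]
    refine intervalIntegral.integral_congr fun u hu => ?_
    rw [uIcc_of_le hx] at hu
    have : (Real.log u : ℂ) ≠ 0 := by exact_mod_cast (Real.log_pos (by linarith [hu.1])).ne'
    simp only [f]
    push_cast
    field_simp
    ring
  have hTi : IntervalIntegrable (fun u => (T u : ℂ)) volume 2 x := by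
    have hTm : Monotone T := fun a b hab =>
      Finset.sum_le_sum_of_subset_of_nonneg (Finset.Icc_zero_subset_of_floor_le hab) fun n _ _ => by
        simp only [c]
        split_ifs
        · exact pow_nonneg (Real.log_natCast_nonneg n) _
        · rfl
    exact ⟨hTm.intervalIntegrable.1.ofReal, hTm.intervalIntegrable.2.ofReal⟩
  have hc' : ContinuousOn f' (uIcc 2 x) := by rwa [uIcc_of_le hx]
  have hi1 : IntervalIntegrable (fun u => f' u * T u) volume 2 x := hTi.continuousOn_mul hc'
  have hi2 : IntervalIntegrable (fun u => f' u * J u) volume 2 x :=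
    (hc'.mul hJc).intervalIntegrable
  have hkey : ∑ n ∈ Finset.Icc 0 ⌊x⌋₊, (if n.Prime then (n : ℂ) ^ s else 0) -
        ∫ u in (2 : ℝ)..x, (u : ℂ) ^ s / Real.log u =
      f x * ((T x - J x : ℝ) : ℂ) - ∫ u in (2 : ℝ)..x, f' u * ((T u - J u : ℝ) : ℂ) := by
    simp only [Complex.ofReal_sub, mul_sub]
    rw [intervalIntegral.integral_sub hi1 hi2, hsum, hparts]
    ring
  rw [hkey, add_mul]
  refine (norm_sub_le _ _).trans (add_le_add ?_ (hint x hx))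
  rw [norm_mul, norm_div, norm_pow, Complex.norm_cpow_eq_rpow_re_of_pos hx0, Complex.norm_real,
    Complex.norm_real, Real.norm_of_nonneg hlx0.le, Real.norm_eq_abs]
  calc _ ≤ x ^ s.re / Real.log x ^ (2 * m + 1) * (C * (x * Real.log x ^ m)) := by
        gcongr
        exact hE x hx
    _ = _ := by
        rw [Real.rpow_add_one hx0.ne',
          show Real.log x ^ (2 * m + 1) = Real.log x ^ m * Real.log x ^ (m + 1) by ring]
        field_simp

lemma tsum_pow_div_factorial_succ {z : ℂ} (hz : z ≠ 0) :
    ∑' k : ℕ, z ^ k / (Nat.factorial (k + 1) : ℂ) = (Complex.exp z - 1) / z := by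
  have h := NormedSpace.expSeries_div_hasSum_exp z
  rw [← Complex.exp_eq_exp_ℂ, ← hasSum_nat_add_iff' 1] at h
  simp only [Finset.sum_range_one, pow_zero, Nat.factorial_zero, Nat.cast_one, div_one] at h
  rw [← (h.div_const z).tsum_eq]
  refine tsum_congr fun k => ?_
  rw [pow_succ]
  field_simp

lemma hasDerivAt_tsum_pow_succ_div {z : ℂ} (hz : z ≠ 0) :
    HasDerivAt (fun w : ℂ => ∑' k : ℕ, w ^ (k + 1) / (((k : ℂ) + 1) * (Nat.factorial (k + 1) : ℂ)))
      ((Complex.exp z - 1) / z) z := by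
  rw [← tsum_pow_div_factorial_succ hz]
  refine hasDerivAt_tsum_of_isPreconnected (Real.summable_pow_div_factorial (‖z‖ + 1))
    Metric.isOpen_ball (convex_ball (0 : ℂ) (‖z‖ + 1)).isPreconnected
    (g' := fun k w => w ^ k / (Nat.factorial (k + 1) : ℂ)) (fun k w _ => ?_) (fun k w hw => ?_)
    (Metric.mem_ball_self (by positivity)) (by simp) (by simp)
  · refine ((hasDerivAt_pow (k + 1) w).div_const _).congr_deriv ?_
    have : (k : ℂ) + 1 ≠ 0 := by exact_mod_cast k.succ_ne_zero
    push_cast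
    rw [mul_div_mul_left _ _ this]
  · rw [norm_div, norm_pow, Complex.norm_natCast]
    have : ‖w‖ ≤ ‖z‖ + 1 := by simpa using (mem_ball_zero_iff.1 hw).le
    gcongr
    exact k.le_succ

lemma hasDerivAt_complexEi {z : ℂ} (hz : z ∈ Complex.slitPlane) :
    HasDerivAt complexEi (Complex.exp z / z) z := by
  have hz0 := Complex.slitPlane_ne_zero hz
  have := ((Complex.hasDerivAt_log hz).const_add (Real.eulerMascheroniConstant : ℂ)).add
    (hasDerivAt_tsum_pow_succ_div hz0)
  refine this.congr_deriv ?_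
  field_simp
  ring

lemma hasDerivAt_complexEi_mul_log {s : ℂ} (hs : -1 < s.re) {u : ℝ} (hu : 1 < u) :
    HasDerivAt (fun v : ℝ => complexEi ((s + 1) * (Real.log v : ℂ)))
      ((u : ℂ) ^ s / Real.log u) u := by
  have hu0 : 0 < u := by linarith
  have hlu := Real.log_pos hu
  have hL : (Real.log u : ℂ) ≠ 0 := by exact_mod_cast hlu.ne'
  have hu' : (u : ℂ) ≠ 0 := by exact_mod_cast hu0.ne'
  have hs0 : s + 1 ≠ 0 := by
    intro h
    have := congrArg Complex.re h
    simp at this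
    linarith
  have hmem : (s + 1) * (Real.log u : ℂ) ∈ Complex.slitPlane := by
    left
    rw [Complex.re_mul_ofReal]
    exact mul_pos (by simp; linarith) hlu
  have h1 := ((Real.hasDerivAt_log hu0.ne').ofReal_comp).const_mul (s + 1)
  refine ((hasDerivAt_complexEi hmem).comp u h1).congr_deriv ?_
  have e : Complex.exp ((s + 1) * (Real.log u : ℂ)) = (u : ℂ) ^ s * u := by
    rw [mul_comm, Complex.ofReal_log hu0.le, ← Complex.cpow_def_of_ne_zero hu',
      Complex.cpow_add _ _ hu', Complex.cpow_one]
  rw [e]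
  push_cast
  field_simp

lemma integral_cpow_div_log {s : ℂ} (hs : -1 < s.re) {x : ℝ} (hx : 2 ≤ x) :
    ∫ u in (2 : ℝ)..x, (u : ℂ) ^ s / Real.log u =
      complexEi ((s + 1) * (Real.log x : ℂ)) - complexEi ((s + 1) * (Real.log 2 : ℂ)) := by
  have hgt : ∀ u ∈ uIcc 2 x, 1 < u := fun u hu => by
    rw [uIcc_of_le hx] at hu
    linarith [hu.1]
  refine intervalIntegral.integral_eq_sub_of_hasDerivAt
    (f := fun v : ℝ => complexEi ((s + 1) * (Real.log v : ℂ)))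
    (fun u hu => hasDerivAt_complexEi_mul_log hs (hgt u hu)) ?_
  refine ContinuousOn.intervalIntegrable ?_
  have := (continuousOn_cpow_mul_log_pow s 1 0 1 1).mono (s := Ioi 1) hgt
  simpa [div_eq_mul_inv] using this

lemma piPow_eq_sum_Icc (s : ℂ) (x : ℝ) :
    piPow s x = ∑ n ∈ Finset.Icc 0 ⌊x⌋₊, if n.Prime then (n : ℂ) ^ s else 0 := by
  rw [piPow, Nat.primesBelow, Finset.sum_filter]
  congr 1
  ext n
  simp

end

/-- For `s ∈ ℂ` with `Re(s) > −1` and every real `t > 0`,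
`∑_{p ≤ x} p^s = Ei((s+1)·log x) + O(x^{Re(s)+1}·(log x)^{−t})` as `x → ∞`. -/
theorem piPow_eq_Ei_add_bigO (s : ℂ) (hs : -1 < s.re) (t : ℝ) (ht : 0 < t) :
    (fun x : ℝ => piPow s x - complexEi ((s + 1) * (Real.log x : ℂ)))
      =O[atTop] fun x : ℝ => x ^ (s.re + 1) * (Real.log x) ^ (-t) := by
  obtain ⟨m, hm⟩ := exists_nat_ge t
  have hm0 : m ≠ 0 := by
    rintro rfl
    simp at hm
    linarith
  obtain ⟨C, hC, h⟩ := exists_norm_sum_prime_cpow_sub_integral_le hs hm0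
  obtain ⟨K, hK, hg⟩ := exists_rpow_div_log_pow_le (by linarith : 0 < s.re + 1) (m + 1)
  set A := (2 : ℝ) ^ (s.re + 1) / Real.log 2 ^ (m + 1)
  have hA : 0 < A := by
    have := Real.log_pos one_lt_two
    positivity
  set c := complexEi ((s + 1) * (Real.log 2 : ℂ))
  refine Asymptotics.IsBigO.of_bound (C + ‖c‖ / A * K) ?_
  filter_upwards [eventually_ge_atTop (3 : ℝ)] with x hx
  have hx0 : 0 < x := by linarith
  have hL : 1 ≤ Real.log x := by
    rw [Real.le_log_iff_exp_le hx0]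
    linarith [Real.exp_one_lt_d9]
  have hL0 : 0 < Real.log x := by linarith
  have h1 := h x (by linarith)
  rw [← piPow_eq_sum_Icc, integral_cpow_div_log hs (by linarith)] at h1
  have h2 := hg 2 x le_rfl (by linarith)
  have hpow : x ^ (s.re + 1) / Real.log x ^ (m + 1) ≤ x ^ (s.re + 1) * Real.log x ^ (-t) := by
    rw [div_eq_mul_inv, ← Real.rpow_natCast, ← Real.rpow_neg hL0.le]
    gcongr
    push_cast
    linarith
  have hc : ‖c‖ ≤ ‖c‖ / A * K * (x ^ (s.re + 1) / Real.log x ^ (m + 1)) := by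
    calc ‖c‖ = ‖c‖ / A * A := by field_simp
      _ ≤ ‖c‖ / A * (K * (x ^ (s.re + 1) / Real.log x ^ (m + 1))) := by gcongr
      _ = _ := by ring
  rw [Real.norm_of_nonneg (by positivity)]
  calc ‖piPow s x - complexEi ((s + 1) * (Real.log x : ℂ))‖
      = ‖(piPow s x - (complexEi ((s + 1) * (Real.log x : ℂ)) - c)) - c‖ := by
        congr 1
        ring
    _ ≤ (C + ‖c‖ / A * K) * (x ^ (s.re + 1) / Real.log x ^ (m + 1)) := by
        rw [add_mul C]
        exact (norm_sub_le _ _).trans (add_le_add h1 hc)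
    _ ≤ _ := by gcongr
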